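/- arXiv:math/0402409 — 5 statements merged into one kernel-verified Lean document; each statement's English description precedes it below -/
import Mathlib

section
/- With the setup of the character-ratio martingale: for a subgroup chain H_{j-1} ⊆ H_j with C_j = C ∩ H_j and C_{j-1} = C ∩ H_{j-1} each a single conjugacy class (or empty), and ρ(j-1), ρ(j) random representations with ρ(j-1) Plancherel distributed on H_{j-1} and ρ(j) obtained via the induction transition, one has E[(Y_j − Y_{j-1})^2] = |C_j| − |C_{j-1}|, where Y_j = |C_j| χ^{ρ(j)}(C_j)/dim(ρ(j)). -/
open FDRep CategoryTheory

open scoped ComplexOrder in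
lemma aux_char_inv {G : Type} [Group G] [Fintype G] (V : FDRep ℂ G) (g : G) :
    V.character g⁻¹ = (starRingEnd ℂ) (V.character g) := by
  classical
  let b := Module.finBasis ℂ V
  let A : G → Matrix _ _ ℂ := fun g => LinearMap.toMatrix b b (V.ρ g)
  have hmul : ∀ x y, A (x * y) = A x * A y := fun x y => by
    simp only [A, map_mul]; exact LinearMap.toMatrix_mul b _ _
  have hone : A 1 = 1 := by
    simp only [A, map_one]; exact LinearMap.toMatrix_one b
  have htr : ∀ x, V.character x = (A x).trace := fun x =>
    LinearMap.trace_eq_matrix_trace ℂ b (V.ρ x)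
  let P : Matrix _ _ ℂ := ∑ x : G, (A x).conjTranspose * A x
  have hP : P.PosDef := by
    have : P = (A 1).conjTranspose * A 1 +
        ∑ x ∈ Finset.univ.erase (1 : G), (A x).conjTranspose * A x :=
      (Finset.add_sum_erase _ _ (Finset.mem_univ _)).symm
    rw [this, hone]
    simp only [Matrix.conjTranspose_one, mul_one]
    refine Matrix.PosDef.one.add_posSemidef ?_
    exact Matrix.posSemidef_sum _ fun x _ => Matrix.posSemidef_conjTranspose_mul_self _
  have hinv : (A g).conjTranspose * P * A g = P := by
    simp only [P, Finset.mul_sum, Finset.sum_mul]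
    rw [← Equiv.sum_comp (Equiv.mulRight g) (fun x => (A x).conjTranspose * A x)]
    refine Finset.sum_congr rfl fun x _ => ?_
    simp [hmul, Matrix.conjTranspose_mul, mul_assoc]
  have hAg : A g * A g⁻¹ = 1 := by rw [← hmul, mul_inv_cancel, hone]
  have hu : IsUnit P.det := (Matrix.isUnit_iff_isUnit_det _).1 hP.isUnit
  have h2 : A g⁻¹ = P⁻¹ * ((A g).conjTranspose * P) := by
    have : (A g).conjTranspose * P = P * A g⁻¹ := by
      conv_rhs => rw [← hinv, mul_assoc, hAg, mul_one]
    rw [this, ← mul_assoc, Matrix.nonsing_inv_mul _ hu, one_mul]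
  rw [htr, htr, h2, Matrix.trace_mul_comm, mul_assoc, Matrix.mul_nonsing_inv _ hu, mul_one,
    Matrix.trace_conjTranspose]
  rfl

/-- representation on a left ideal -/
noncomputable def auxRep {G : Type} [Group G] (S : Submodule (MonoidAlgebra ℂ G) (MonoidAlgebra ℂ G)) :
    Representation ℂ G S :=
  ((Algebra.lsmul ℂ ℂ S : MonoidAlgebra ℂ G →ₐ[ℂ] Module.End ℂ S) : MonoidAlgebra ℂ G →* Module.End ℂ S).comp
    (MonoidAlgebra.of ℂ G)

lemma auxRep_apply {G : Type} [Group G] (S : Submodule (MonoidAlgebra ℂ G) (MonoidAlgebra ℂ G))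
    (g : G) (v : S) : auxRep S g v = MonoidAlgebra.of ℂ G g • v := rfl

instance auxFin {G : Type} [Group G] [Fintype G] (S : Submodule (MonoidAlgebra ℂ G) (MonoidAlgebra ℂ G)) :
    Module.Finite ℂ S := by
  have : Module.Finite ℂ (MonoidAlgebra ℂ G) := 
    Module.Finite.of_basis (MonoidAlgebra.basis G ℂ)
  exact Module.Finite.of_injective (S.subtype.restrictScalars ℂ) S.injective_subtype

lemma aux_lin {G : Type} [Group G] (S : Submodule (MonoidAlgebra ℂ G) (MonoidAlgebra ℂ G))
    (T : S →ₗ[ℂ] S) (hT : ∀ g v, T (MonoidAlgebra.of ℂ G g • v) = MonoidAlgebra.of ℂ G g • T v)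
    (a : MonoidAlgebra ℂ G) (v : S) : T (a • v) = a • T v := by
  induction a using MonoidAlgebra.induction_on with
  | of g => exact hT g v
  | add x y hx hy => simp [add_smul, hx, hy]
  | smul r x hx => simp [smul_assoc, hx]

lemma aux_scalar {G : Type} [Group G] [Fintype G] (S : Submodule (MonoidAlgebra ℂ G) (MonoidAlgebra ℂ G))
    [IsSimpleModule (MonoidAlgebra ℂ G) S]
    (T : S →ₗ[ℂ] S) (hT : ∀ g v, T (MonoidAlgebra.of ℂ G g • v) = MonoidAlgebra.of ℂ G g • T v) :
    ∃ c : ℂ, ∀ v, T v = c • v := by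
  obtain ⟨c, hc⟩ := (IsSimpleModule.algebraMap_end_bijective_of_isAlgClosed
    (A := MonoidAlgebra ℂ G) (V := S) ℂ).2
    { toFun := T, map_add' := T.map_add, map_smul' := aux_lin S T hT }
  exact ⟨c, fun v => (LinearMap.congr_fun hc v).symm⟩

lemma aux_simple {G : Type} [Group G] [Fintype G] (S : Submodule (MonoidAlgebra ℂ G) (MonoidAlgebra ℂ G))
    [IsSimpleModule (MonoidAlgebra ℂ G) S] : Simple (FDRep.of (auxRep S)) := by
  rw [FDRep.simple_iff_end_is_rank_one]
  have hnt : Nontrivial S := IsSimpleModule.nontrivial (MonoidAlgebra ℂ G) S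
  obtain ⟨v, hv⟩ := exists_ne (0 : S)
  have h1 : (𝟙 (FDRep.of (auxRep S))) ≠ 0 := by
    intro h
    apply hv
    have := congrArg (fun f => f.hom.hom.hom v) h
    exact this
  rw [finrank_eq_one_iff_of_nonzero' _ h1]
  intro f
  obtain ⟨c, hc⟩ := aux_scalar S f.hom.hom.hom (fun g v => by
    have := congrArg (fun f => f.hom.hom v) (f.comm g)
    exact this)
  refine ⟨c, ?_⟩
  ext w : 4
  exact congrArg Subtype.val (hc w).symm

lemma aux_vanish {G : Type} [Group G] [Fintype G] {ι : Type} [Fintype ι] (ρ : ι → FDRep ℂ G)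
    (hcomplete : ∀ V : FDRep ℂ G, Simple V → ∃ i, Nonempty (ρ i ≅ V))
    (f : G → ℂ) (hf : ∀ g x, f (x * g * x⁻¹) = f g)
    (h : ∀ i, ∑ g, f g * (ρ i).character g = 0) (g : G) : f g = 0 := by
  classical
  let z : MonoidAlgebra ℂ G := ∑ g, f g • MonoidAlgebra.of ℂ G g
  have hz : ∀ x : G, z * MonoidAlgebra.of ℂ G x = MonoidAlgebra.of ℂ G x * z := by
    intro x
    simp only [z, Finset.mul_sum, Finset.sum_mul, smul_mul_assoc, mul_smul_comm, ← map_mul]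
    rw [← Equiv.sum_comp (MulAut.conj x).toEquiv]
    refine Finset.sum_congr rfl fun y _ => ?_
    simp [hf]
  have key : ∀ S : Submodule (MonoidAlgebra ℂ G) (MonoidAlgebra ℂ G),
      IsSimpleModule (MonoidAlgebra ℂ G) S → ∀ v : S, z • v = 0 := by
    intro S hS
    obtain ⟨c, hc⟩ := aux_scalar S (Algebra.lsmul ℂ ℂ S z) (fun g v => by
      simp only [Algebra.lsmul_coe, ← mul_smul, hz])
    have hc' : Algebra.lsmul ℂ ℂ S z = c • (LinearMap.id : S →ₗ[ℂ] S) := by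
      ext1 v; exact hc v
    obtain ⟨i, ⟨e⟩⟩ := hcomplete _ (aux_simple S)
    have htr : LinearMap.trace ℂ S (Algebra.lsmul ℂ ℂ S z) = 0 := by
      rw [← h i, FDRep.char_iso e]
      simp only [z, map_sum, map_smul, smul_eq_mul]
      rfl
    rw [hc', map_smul, LinearMap.trace_id, smul_eq_mul, mul_eq_zero] at htr
    have hnt : Nontrivial S := IsSimpleModule.nontrivial (MonoidAlgebra ℂ G) S
    have hpos : Module.finrank ℂ S ≠ 0 := Module.finrank_pos.ne'
    have hc0 : c = 0 := htr.resolve_right (by exact_mod_cast hpos)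
    intro v
    have := hc v
    rw [hc0, zero_smul] at this
    exact this
  let L : Submodule (MonoidAlgebra ℂ G) (MonoidAlgebra ℂ G) :=
    { carrier := {v | z * v = 0}
      add_mem' := fun {a b} ha hb => by
        simp only [Set.mem_ofPred_eq] at *; rw [mul_add, ha, hb, add_zero]
      zero_mem' := by simp
      smul_mem' := fun a v hv => by
        simp only [Set.mem_ofPred_eq] at *
        have hza : z * a = a * z := by
          induction a using MonoidAlgebra.induction_on with
          | of g => exact hz g
          | add x y hx hy => rw [mul_add, add_mul, hx, hy]
          | smul r x hx => rw [mul_smul_comm, smul_mul_assoc, hx]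
        rw [smul_eq_mul, ← mul_assoc, hza, mul_assoc, hv, mul_zero] }
  have hL : L = ⊤ := by
    rw [eq_top_iff, ← IsSemisimpleModule.sSup_simples_eq_top (MonoidAlgebra ℂ G) (MonoidAlgebra ℂ G)]
    refine sSup_le fun S hS v hv => ?_
    have := congrArg Subtype.val (key S hS ⟨v, hv⟩)
    exact this
  have hz0 : z = 0 := by
    have : (1 : MonoidAlgebra ℂ G) ∈ L := by rw [hL]; trivial
    have h1 : z * 1 = 0 := this
    rwa [mul_one] at h1
  have hb := (MonoidAlgebra.basis G ℂ).linearIndependent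
  rw [Fintype.linearIndependent_iff] at hb
  refine hb f ?_ g
  rw [← hz0]
  simp [z]

lemma aux_char_isConj {G : Type} [Group G] (V : FDRep ℂ G) {g h : G} (hgh : IsConj g h) :
    V.character g = V.character h := by
  obtain ⟨x, rfl⟩ := isConj_iff.1 hgh
  simp

open scoped Classical in
lemma aux_col {G : Type} [Group G] [Fintype G] {ι : Type} [Fintype ι] (ρ : ι → FDRep ℂ G)
    (hsimple : ∀ i, Simple (ρ i))
    (hdistinct : ∀ i j, i ≠ j → ¬ Nonempty (ρ i ≅ ρ j))
    (hcomplete : ∀ V : FDRep ℂ G, Simple V → ∃ i, Nonempty (ρ i ≅ V)) (h g : G) :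
    (Nat.card {x : G // IsConj h x} : ℂ) *
      ∑ i, (ρ i).character h * (starRingEnd ℂ) ((ρ i).character g) =
      if IsConj h g then (Fintype.card G : ℂ) else 0 := by
  have hG : (Nat.card G : ℂ) ≠ 0 := by simp
  have := invertibleOfNonzero hG
  set N : ℂ := (Nat.card {x : G // IsConj h x} : ℂ) with hN
  have horth : ∀ i j, ∑ g, (ρ i).character g * (ρ j).character g⁻¹ =
      if i = j then (Nat.card G : ℂ) else 0 := by
    intro i j
    have := hsimple i
    have := hsimple j
    have h1 := FDRep.char_orthonormal (ρ i) (ρ j)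
    rw [inv_mul_eq_iff_eq_mul₀ hG] at h1
    rw [h1]
    by_cases hij : i = j
    · subst hij
      rw [if_pos ⟨Iso.refl _⟩, if_pos rfl]; simp
    · rw [if_neg (hdistinct i j hij), if_neg hij]; simp
  have hclass : ∀ j, ∑ g, (if IsConj h g then (Nat.card G : ℂ) else 0) * (ρ j).character g =
      Nat.card G * (N * (ρ j).character h) := by
    intro j
    rw [hN, Nat.card_eq_fintype_card (α := {x : G // IsConj h x}), Fintype.card_subtype, Finset.card_eq_sum_ones]
    push_cast
    rw [Finset.sum_filter, Finset.sum_mul, Finset.mul_sum]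
    refine Finset.sum_congr rfl fun x _ => ?_
    split_ifs with hx
    · rw [aux_char_isConj _ hx]; ring
    · simp
  have hv := aux_vanish ρ hcomplete
    (fun g => (if IsConj h g then (Nat.card G : ℂ) else 0) -
      N * ∑ i, (ρ i).character h * (ρ i).character g⁻¹) ?_ ?_ g
  · rw [sub_eq_zero] at hv
    simp only [← aux_char_inv]
    rw [← hv, Nat.card_eq_fintype_card]
  · intro g x
    have h1 : IsConj h (x * g * x⁻¹) ↔ IsConj h g := by
      have : IsConj g (x * g * x⁻¹) := isConj_iff.2 ⟨x, rfl⟩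
      exact ⟨fun t => t.trans this.symm, fun t => t.trans this⟩
    have h2 : (x * g * x⁻¹)⁻¹ = x * g⁻¹ * x⁻¹ := by group
    simp only [h1, h2, FDRep.char_conj]
  · intro j
    simp only [sub_mul, Finset.sum_sub_distrib]
    rw [hclass, sub_eq_zero]
    simp only [Finset.mul_sum, Finset.sum_mul]
    rw [Finset.sum_comm]
    have : ∀ i, ∑ y, N * ((ρ i).character h * (ρ i).character y⁻¹) * (ρ j).character y =
        N * (ρ i).character h * ∑ y, (ρ j).character y * (ρ i).character y⁻¹ := by
      intro i
      rw [Finset.mul_sum]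
      exact Finset.sum_congr rfl fun _ _ => by ring
    simp only [this, horth]
    simp
    ring

lemma aux_dim {G : Type} [Group G] [Fintype G] (V : FDRep ℂ G) (hV : Simple V) :
    (Module.finrank ℂ V : ℂ) ≠ 0 := by
  intro h0
  have h0' : Module.finrank ℂ V = 0 := by exact_mod_cast h0
  have hs : Subsingleton V := Module.finrank_zero_iff.1 h0'
  have hc : ∀ g, V.character g = 0 := by
    intro g
    have : V.ρ g = 0 := by ext v; exact Subsingleton.elim _ _
    rw [FDRep.character, this, map_zero]
  have := (FDRep.simple_iff_char_is_norm_one V).1 hV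
  simp only [hc, mul_zero, Finset.sum_const_zero] at this
  exact NeZero.ne (Nat.card G : ℂ) this.symm

lemma aux_one_conj {G : Type} [Group G] : Nat.card {x : G // IsConj 1 x} = 1 := by
  simp [isConj_one_right]

/-- Quadratic variation of the character-ratio martingale at one step of a subgroup chain.
Let `K ⊆ H` be finite groups, `C` the conjugacy class of `c` in `H` (a single class, with
all irreducible characters of `H` real on `C`), such that `C ∩ K` is either empty or a
single conjugacy class of `K` (with all irreducible characters of `K` real on it, `k₀`
being a representative whenever it is nonempty).  Choose `ρ(j-1) = σ i` from Plancherel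
measure of `K` and then `ρ(j) = ρ j'` via the induction transition
`P = |K| · dim(τ) · κ(σ,τ)/(|H| · dim(σ))`.  With
`Y_j = |C| · χ^{ρ(j)}(C)/dim ρ(j)` and `Y_{j-1} = |C ∩ K| · χ^{ρ(j-1)}(C ∩ K)/dim ρ(j-1)`
one has `E[(Y_j − Y_{j-1})^2] = |C| − |C ∩ K|`. -/
theorem character_ratio_martingale_quadratic_variation
    {H : Type} [Group H] [Fintype H] (K : Subgroup H) [Fintype K]
    {ι : Type} [Fintype ι] (ρ : ι → FDRep ℂ H)
    (hsimple : ∀ i, Simple (ρ i))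
    (hdistinct : ∀ i j, i ≠ j → ¬ Nonempty (ρ i ≅ ρ j))
    (hcomplete : ∀ V : FDRep ℂ H, Simple V → ∃ i, Nonempty (ρ i ≅ V))
    {κι : Type} [Fintype κι] (σ : κι → FDRep ℂ K)
    (hsimple' : ∀ i, Simple (σ i))
    (hdistinct' : ∀ i j, i ≠ j → ¬ Nonempty (σ i ≅ σ j))
    (hcomplete' : ∀ V : FDRep ℂ K, Simple V → ∃ i, Nonempty (σ i ≅ V))
    (c : H)
    (hreal : ∀ i, ∀ g : H, IsConj c g → ∃ r : ℝ, (ρ i).character g = (r : ℂ))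
    (hreal' : ∀ i, ∀ k : K, IsConj c (↑k : H) → ∃ r : ℝ, (σ i).character k = (r : ℂ))
    (hsingle : ∀ k₁ k₂ : K, IsConj c (↑k₁ : H) → IsConj c (↑k₂ : H) → IsConj k₁ k₂)
    (k₀ : K) (hk₀ : (∃ k : K, IsConj c (↑k : H)) → IsConj c (↑k₀ : H)) :
    ∑ i, ∑ j,
      (((Module.finrank ℂ (σ i) : ℂ) ^ 2 / (Fintype.card K : ℂ)) *
        ((Fintype.card K : ℂ) * (Module.finrank ℂ (ρ j) : ℂ) *
          ((∑ k : K, (ρ j).character (↑k) * (starRingEnd ℂ) ((σ i).character k)) /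
            (Fintype.card K : ℂ)) /
          ((Fintype.card H : ℂ) * (Module.finrank ℂ (σ i) : ℂ)))) *
        ((Nat.card {g : H // IsConj c g} : ℂ) * (ρ j).character c /
            (Module.finrank ℂ (ρ j) : ℂ) -
          (Nat.card {k : K // IsConj c (↑k : H)} : ℂ) * (σ i).character k₀ /
            (Module.finrank ℂ (σ i) : ℂ)) ^ 2 =
      (Nat.card {g : H // IsConj c g} : ℂ) - (Nat.card {k : K // IsConj c (↑k : H)} : ℂ) := by
  classical
  have hH0 : (Fintype.card H : ℂ) ≠ 0 := by simp
  have hK0 : (Fintype.card K : ℂ) ≠ 0 := by simp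
  set N : ℂ := (Nat.card {g : H // IsConj c g} : ℂ) with hN
  set N' : ℂ := (Nat.card {k : K // IsConj c (↑k : H)} : ℂ) with hN'
  have hd : ∀ i, (Module.finrank ℂ (σ i) : ℂ) ≠ 0 := fun i => aux_dim _ (hsimple' i)
  have he : ∀ j, (Module.finrank ℂ (ρ j) : ℂ) ≠ 0 := fun j => aux_dim _ (hsimple j)
  have hrc : ∀ j, (starRingEnd ℂ) ((ρ j).character c) = (ρ j).character c := by
    intro j
    obtain ⟨r, hr⟩ := hreal j c (IsConj.refl c)
    rw [hr, Complex.conj_ofReal]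
  have colH : ∀ g : H, N * ∑ j, (ρ j).character c * (ρ j).character g =
      if IsConj c g then (Fintype.card H : ℂ) else 0 := by
    intro g
    have h1 := congrArg (starRingEnd ℂ) (aux_col ρ hsimple hdistinct hcomplete c g)
    simp only [map_mul, map_sum, Complex.conj_conj, hrc, map_natCast, apply_ite (starRingEnd ℂ),
      map_zero] at h1
    exact h1
  have colH1 : ∀ g : H, ∑ j, (Module.finrank ℂ (ρ j) : ℂ) * (ρ j).character g =
      if g = 1 then (Fintype.card H : ℂ) else 0 := by
    intro g
    have h1 := congrArg (starRingEnd ℂ) (aux_col ρ hsimple hdistinct hcomplete 1 g)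
    simp only [map_mul, map_sum, Complex.conj_conj, map_natCast, apply_ite (starRingEnd ℂ),
      map_zero, isConj_one_right, FDRep.char_one, aux_one_conj] at h1
    simpa using h1
  have colK1 : ∀ k : K, ∑ i, (Module.finrank ℂ (σ i) : ℂ) *
      (starRingEnd ℂ) ((σ i).character k) =
      if k = 1 then (Fintype.card K : ℂ) else 0 := by
    intro k
    have h1 := aux_col σ hsimple' hdistinct' hcomplete' 1 k
    simp only [FDRep.char_one, aux_one_conj] at h1
    simpa [eq_comm] using h1
  have colK : ∀ k : K, N' * ∑ i, (σ i).character k₀ * (starRingEnd ℂ) ((σ i).character k) =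
      if IsConj c (k : H) then (Fintype.card K : ℂ) else 0 := by
    intro k
    by_cases hex : ∃ k : K, IsConj c (↑k : H)
    · have hck := hk₀ hex
      have hiff : ∀ k : K, IsConj k₀ k ↔ IsConj c (k : H) := fun k =>
        ⟨fun h => hck.trans (K.subtype.map_isConj h), fun h => hsingle _ _ hck h⟩
      have h1 := aux_col σ hsimple' hdistinct' hcomplete' k₀ k
      simp only [hiff] at h1
      exact h1
    · have hE : IsEmpty {k : K // IsConj c (↑k : H)} := ⟨fun x => hex ⟨x.1, x.2⟩⟩
      have h0 : N' = 0 := by rw [hN', Nat.card_of_isEmpty, Nat.cast_zero]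
      rw [h0, zero_mul, if_neg fun h => hex ⟨k, h⟩]
  have hcount : ∑ k : K, (if IsConj c (k : H) then (1 : ℂ) else 0) = N' := by
    rw [hN', Nat.card_eq_fintype_card (α := {k : K // IsConj c (↑k : H)}), Fintype.card_subtype,
      Finset.card_eq_sum_ones]
    push_cast
    rw [Finset.sum_filter]
  have R4 : N ^ 2 * ∑ j, (ρ j).character c ^ 2 = N * Fintype.card H := by
    have := colH c
    rw [if_pos (IsConj.refl c)] at this
    simp only [pow_two, mul_assoc, this]
  have R5 : N' ^ 2 * ∑ i, (σ i).character k₀ ^ 2 = N' * Fintype.card K := by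
    by_cases hex : ∃ k : K, IsConj c (↑k : H)
    · have hck := hk₀ hex
      have := colK k₀
      have hr : ∀ i, (starRingEnd ℂ) ((σ i).character k₀) = (σ i).character k₀ := by
        intro i
        obtain ⟨r, hr⟩ := hreal' i k₀ hck
        rw [hr, Complex.conj_ofReal]
      simp only [hr, if_pos hck] at this
      simp only [pow_two, mul_assoc, this]
    · have hE : IsEmpty {k : K // IsConj c (↑k : H)} := ⟨fun x => hex ⟨x.1, x.2⟩⟩
      have h0 : N' = 0 := by rw [hN', Nat.card_of_isEmpty, Nat.cast_zero]
      simp [h0]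
  let S : κι → ι → ℂ := fun i j =>
    ∑ k : K, (ρ j).character (↑k) * (starRingEnd ℂ) ((σ i).character k)
  have R1 : ∀ j, ∑ i, (Module.finrank ℂ (σ i) : ℂ) * S i j =
      Fintype.card K * Module.finrank ℂ (ρ j) := by
    intro j
    simp only [S, Finset.mul_sum]
    rw [Finset.sum_comm]
    have : ∀ k : K, ∑ i, (Module.finrank ℂ (σ i) : ℂ) *
        ((ρ j).character (k : H) * (starRingEnd ℂ) ((σ i).character k)) =
        (ρ j).character (k : H) * if k = 1 then (Fintype.card K : ℂ) else 0 := by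
      intro k
      rw [← colK1, Finset.mul_sum]
      exact Finset.sum_congr rfl fun _ _ => by ring
    rw [Finset.sum_congr rfl fun k _ => this k]
    simp [mul_comm]
  have R2 : ∀ i, ∑ j, (Module.finrank ℂ (ρ j) : ℂ) * S i j =
      Fintype.card H * Module.finrank ℂ (σ i) := by
    intro i
    simp only [S, Finset.mul_sum]
    rw [Finset.sum_comm]
    have : ∀ k : K, ∑ j, (Module.finrank ℂ (ρ j) : ℂ) *
        ((ρ j).character (k : H) * (starRingEnd ℂ) ((σ i).character k)) =
        (starRingEnd ℂ) ((σ i).character k) * if k = 1 then (Fintype.card H : ℂ) else 0 := by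
      intro k
      have h1 := colH1 (k : H)
      simp only [OneMemClass.coe_eq_one] at h1
      rw [← h1, Finset.mul_sum]
      exact Finset.sum_congr rfl fun _ _ => by ring
    rw [Finset.sum_congr rfl fun k _ => this k]
    simp [mul_comm]
  have R3 : ∑ i, ∑ j, (N * (ρ j).character c) * (N' * (σ i).character k₀) * S i j =
      Fintype.card H * Fintype.card K * N' := by
    have h1 : ∀ k : K, (N * ∑ j, (ρ j).character c * (ρ j).character (k : H)) *
        (N' * ∑ i, (σ i).character k₀ * (starRingEnd ℂ) ((σ i).character k)) =
        Fintype.card H * Fintype.card K * if IsConj c (k : H) then (1 : ℂ) else 0 := by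
      intro k
      rw [colH, colK]
      split_ifs <;> simp
    have h3 : (Fintype.card H : ℂ) * Fintype.card K * N' = Fintype.card H * Fintype.card K *
        ∑ k : K, (if IsConj c (k : H) then (1 : ℂ) else 0) := by rw [hcount]
    rw [h3, Finset.mul_sum, ← Finset.sum_congr rfl fun k _ => h1 k]
    simp only [S, Finset.mul_sum, Finset.sum_mul]
    have h2 : ∀ i : κι, ∑ j : ι, ∑ k : K, N * (ρ j).character c * (N' * (σ i).character k₀) *
        ((ρ j).character (k : H) * (starRingEnd ℂ) ((σ i).character k)) =
        ∑ k : K, ∑ j : ι, N * (ρ j).character c * (N' * (σ i).character k₀) *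
        ((ρ j).character (k : H) * (starRingEnd ℂ) ((σ i).character k)) := fun i =>
      Finset.sum_comm
    rw [Finset.sum_congr rfl fun i _ => h2 i, Finset.sum_comm]
    refine Finset.sum_congr rfl fun k _ => ?_
    refine Finset.sum_congr rfl fun i _ => ?_
    refine Finset.sum_congr rfl fun j _ => ?_
    ring
  have hterm : ∀ i j, (((Module.finrank ℂ (σ i) : ℂ) ^ 2 / (Fintype.card K : ℂ)) *
        ((Fintype.card K : ℂ) * (Module.finrank ℂ (ρ j) : ℂ) *
          ((∑ k : K, (ρ j).character (↑k) * (starRingEnd ℂ) ((σ i).character k)) /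
            (Fintype.card K : ℂ)) /
          ((Fintype.card H : ℂ) * (Module.finrank ℂ (σ i) : ℂ)))) *
        (N * (ρ j).character c / (Module.finrank ℂ (ρ j) : ℂ) -
          N' * (σ i).character k₀ / (Module.finrank ℂ (σ i) : ℂ)) ^ 2 =
      ((Fintype.card H : ℂ) * Fintype.card K)⁻¹ *
        (N ^ 2 * (ρ j).character c ^ 2 / Module.finrank ℂ (ρ j) *
            (Module.finrank ℂ (σ i) * S i j)
          - 2 * ((N * (ρ j).character c) * (N' * (σ i).character k₀) * S i j)
          + N' ^ 2 * (σ i).character k₀ ^ 2 / Module.finrank ℂ (σ i) *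
            (Module.finrank ℂ (ρ j) * S i j)) := by
    intro i j
    change _ * (_ * (S i j / _) / _) * _ = _
    have h1 := hd i
    have h2 := he j
    generalize S i j = s
    generalize (Module.finrank ℂ (σ i) : ℂ) = d at *
    generalize (Module.finrank ℂ (ρ j) : ℂ) = e at *
    field_simp
    ring
  simp only [hterm]
  have E1 : ∑ i, ∑ j, N ^ 2 * (ρ j).character c ^ 2 / Module.finrank ℂ (ρ j) *
      (Module.finrank ℂ (σ i) * S i j) = N * Fintype.card H * Fintype.card K := by
    rw [Finset.sum_comm, ← R4, Finset.mul_sum, Finset.sum_mul]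
    refine Finset.sum_congr rfl fun j _ => ?_
    rw [← Finset.mul_sum, R1]
    have := he j
    field_simp
  have E2 : ∑ i, ∑ j, N' ^ 2 * (σ i).character k₀ ^ 2 / Module.finrank ℂ (σ i) *
      (Module.finrank ℂ (ρ j) * S i j) = N' * Fintype.card K * Fintype.card H := by
    rw [← R5, Finset.mul_sum, Finset.sum_mul]
    refine Finset.sum_congr rfl fun i _ => ?_
    rw [← Finset.mul_sum, R2]
    have := hd i
    field_simp
  simp only [← Finset.mul_sum, Finset.sum_add_distrib, Finset.sum_sub_distrib] at E1 E2 R3 ⊢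
  rw [E1, E2, R3]
  field_simp
  ring
end

section
/- Frobenius' formula: for a partition λ of n ≥ 2, the character ratio of the symmetric group S_n on a transposition satisfies χ^λ(1 2)/dim(λ) = (1/C(n,2)) Σ_i (C(λ_i, 2) − C(λ'_i, 2)), where λ_i are the row lengths and λ'_i the column lengths of λ. -/
open FDRep CategoryTheory Equiv

open scoped Classical

namespace FrobRatio

section Serre
variable {A : Type*} [Ring A]

/-- The commutator element. -/
def wel (u : ℕ → A) (i : ℕ) : A := u (i + 1) * u i - u i * u (i + 1)

theorem W_eq (u : ℕ → A) (hc : ∀ i j, i + 2 ≤ j → Commute (u i) (u j)) (M : ℕ) :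
    (∑ i ∈ Finset.range (M + 1), (i : A) * u i) * (∑ i ∈ Finset.range (M + 1), u i)
      - (∑ i ∈ Finset.range (M + 1), u i) * (∑ i ∈ Finset.range (M + 1), (i : A) * u i)
      = ∑ i ∈ Finset.range M, wel u i := by
  induction M with
  | zero => simp
  | succ K ih =>
    rw [Finset.sum_range_succ _ (K + 1), Finset.sum_range_succ _ (K + 1),
      Finset.sum_range_succ (wel u) K, ← ih]
    have h1 : Commute (∑ i ∈ Finset.range K, u i) (u (K + 1)) :=
      Commute.sum_left _ _ _ fun i hi => hc _ _ (by have := Finset.mem_range.1 hi; omega)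
    have h2 : Commute (∑ i ∈ Finset.range K, (i : A) * u i) (u (K + 1)) :=
      Commute.sum_left _ _ _ fun i hi =>
        (Nat.cast_commute _ _).mul_left (hc _ _ (by have := Finset.mem_range.1 hi; omega))
    rw [Finset.sum_range_succ _ K, Finset.sum_range_succ _ K]
    set S := ∑ i ∈ Finset.range K, u i
    set T := ∑ i ∈ Finset.range K, (i : A) * u i
    unfold wel
    have h1' := h1.eq
    have h2' := h2.eq
    push_cast
    have e1 : (K : A) * u K = u K * K := (Nat.cast_commute K (u K)).eq
    have e2 : (K : A) * u (K + 1) = u (K + 1) * K := (Nat.cast_commute K _).eq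
    have e3 : (K : A) * S = S * K := (Nat.cast_commute K _).eq
    have e7 : S * (u (K + 1) * K) = u (K + 1) * (S * K) := by rw [← mul_assoc, h1', mul_assoc]
    simp only [mul_add, add_mul, mul_assoc, e1, e2, e3, e7, one_mul, h1', h2']
    abel

theorem serre (u : ℕ → A) (hc : ∀ i j, i + 2 ≤ j → Commute (u i) (u j))
    (h0 : ∀ i, u i * u i = 0) (h1 : ∀ i, u i * u (i + 1) * u i = 0)
    (h2 : ∀ i, u (i + 1) * u i * u (i + 1) = 0) (M : ℕ) :
    (∑ i ∈ Finset.range M, wel u i) * (∑ i ∈ Finset.range (M + 1), u i)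
      = (∑ i ∈ Finset.range (M + 1), u i) * (∑ i ∈ Finset.range M, wel u i) := by
  have hw1 : ∀ i, wel u i * u i = u i * wel u i := fun i => by
    have a := h1 i
    rw [mul_assoc] at a
    simp only [wel, mul_sub, sub_mul, mul_assoc, h0, mul_zero, a]
    rw [← mul_assoc (u i) (u i), h0]; simp
  have hw2 : ∀ i, wel u i * u (i + 1) = u (i + 1) * wel u i := fun i => by
    have a := h2 i
    rw [mul_assoc] at a
    simp only [wel, mul_sub, sub_mul, mul_assoc, h0, mul_zero, a]
    rw [← mul_assoc (u (i + 1)) (u (i + 1)), h0]; simp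
  induction M with
  | zero => simp
  | succ K ih =>
    rw [Finset.sum_range_succ _ (K + 1), Finset.sum_range_succ _ K, mul_add, add_mul, add_mul,
      mul_add, add_mul, ih]
    rcases K with _ | K
    · simp [hw1, hw2, add_mul]
    have c1 : Commute (∑ i ∈ Finset.range K, wel u i) (u (K + 2)) :=
      Commute.sum_left _ _ _ fun i hi => by
        have := Finset.mem_range.1 hi
        have a := hc i (K + 2) (by omega)
        have b := hc (i + 1) (K + 2) (by omega)
        exact (b.mul_left a).sub_left (a.mul_left b)
    have c2 : Commute (∑ i ∈ Finset.range K, u i) (wel u (K + 1)) :=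
      Commute.sum_left _ _ _ fun i hi => by
        have := Finset.mem_range.1 hi
        have a := hc i (K + 2) (by omega)
        have b := hc i (K + 1) (by omega)
        exact (a.mul_right b).sub_right (b.mul_right a)
    have key : wel u K * u (K + 2) + wel u (K + 1) * u K
        = u (K + 2) * wel u K + u K * wel u (K + 1) := by
      have e := (hc K (K + 2) le_rfl).eq
      have e' : ∀ x, u K * (u (K + 2) * x) = u (K + 2) * (u K * x) := fun x => by
        rw [← mul_assoc, e, mul_assoc]
      simp only [wel, mul_sub, sub_mul, mul_assoc, e, e', add_assoc, Nat.reduceAdd]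
      abel
    rw [Finset.sum_range_succ _ K, Finset.sum_range_succ _ (K + 1), Finset.sum_range_succ _ K]
    simp only [mul_add, add_mul, add_assoc, Nat.reduceAdd] at key ⊢
    rw [c1.eq, ← c2.eq, hw1 (K + 1), hw2 (K + 1)]
    have k2 := eq_sub_of_add_eq key
    simp only [add_assoc, Nat.reduceAdd] at k2 ⊢
    rw [k2]
    abel

end Serre

section Young

/-- Content of a cell. -/
def cont (p : ℕ × ℕ) : ℤ := (p.2 : ℤ) - p.1

/-- Removable cells. -/
def IsCorner (l : YoungDiagram) (p : ℕ × ℕ) : Prop :=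
  p ∈ l ∧ (p.1 + 1, p.2) ∉ l ∧ (p.1, p.2 + 1) ∉ l

/-- Remove a corner. -/
noncomputable def er (l : YoungDiagram) (p : ℕ × ℕ) : YoungDiagram :=
  if h : IsCorner l p then
    ⟨l.cells.erase p, by
      rintro ⟨a, b⟩ ⟨c, d⟩ hle hm
      simp only [Finset.coe_erase, Set.mem_sdiff, Finset.mem_coe, Set.mem_singleton_iff] at hm ⊢
      obtain ⟨hm, hne⟩ := hm
      have hle' : c ≤ a ∧ d ≤ b := hle
      refine ⟨l.up_left_mem hle'.1 hle'.2 hm, ?_⟩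
      rintro rfl
      obtain ⟨h1, h2, h3⟩ := h
      simp only at h1 h2 h3
      by_cases hca : c = a
      · subst hca
        have : d + 1 ≤ b := by
          rcases Nat.lt_or_ge d b with h | h
          · exact h
          · exact absurd (by rw [le_antisymm hle'.2 h]) hne
        exact h3 (l.up_left_mem le_rfl this hm)
      · exact h2 (l.up_left_mem (by omega) hle'.2 hm)⟩
  else l

theorem er_cells {l : YoungDiagram} {p : ℕ × ℕ} (h : IsCorner l p) :
    (er l p).cells = l.cells.erase p := by
  rw [er, dif_pos h]

theorem mem_er {l : YoungDiagram} {p q : ℕ × ℕ} (h : IsCorner l p) :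
    q ∈ er l p ↔ q ≠ p ∧ q ∈ l := by
  rw [← YoungDiagram.mem_cells, er_cells h, Finset.mem_erase, YoungDiagram.mem_cells]

/-- The finset of corners. -/
noncomputable def corners (l : YoungDiagram) : Finset (ℕ × ℕ) := l.cells.filter (IsCorner l)

theorem mem_corners {l : YoungDiagram} {p : ℕ × ℕ} : p ∈ corners l ↔ IsCorner l p := by
  simp only [corners, Finset.mem_filter, YoungDiagram.mem_cells]
  exact ⟨fun h => h.2, fun h => ⟨h.1, h⟩⟩

theorem er_card {l : YoungDiagram} {p : ℕ × ℕ} (h : p ∈ corners l) :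
    (er l p).card + 1 = l.card := by
  rw [mem_corners] at h
  rw [YoungDiagram.card, er_cells h]
  exact Finset.card_erase_add_one h.1

/-- Removal operator for content `j`. -/
noncomputable def u (j : ℤ) : Module.End ℂ (YoungDiagram → ℂ) where
  toFun f l := ∑ p ∈ corners l with cont p = j, f (er l p)
  map_add' f g := by ext l; simp [Finset.sum_add_distrib]
  map_smul' c f := by ext l; simp [Finset.mul_sum]

theorem u_apply (j : ℤ) (f : YoungDiagram → ℂ) (l : YoungDiagram) :
    u j f l = ∑ p ∈ corners l with cont p = j, f (er l p) := rfl

theorem u_sq (j : ℤ) : u j * u j = 0 := by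
  ext f l
  simp only [Module.End.mul_apply, u_apply, LinearMap.zero_apply, Pi.zero_apply]
  refine Finset.sum_eq_zero fun p hp => Finset.sum_eq_zero fun q hq => ?_
  exfalso
  simp only [Finset.mem_filter, mem_corners] at hp hq
  obtain ⟨hp, hpc⟩ := hp
  obtain ⟨hq, hqc⟩ := hq
  obtain ⟨a, b⟩ := p
  obtain ⟨c, d⟩ := q
  obtain ⟨q1, q2, q3⟩ := hq
  rw [mem_er hp] at q1 q2 q3
  simp only [cont] at hpc hqc
  obtain ⟨p1, p2, p3⟩ := hp
  simp only at p1 p2 p3 q1 q2 q3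
  rcases lt_trichotomy a c with h | h | h
  · exact p2 (l.up_left_mem h (by omega) q1.2)
  · exact q1.1 (by ext <;> simp <;> omega)
  · refine q2 ⟨?_, l.up_left_mem h (by omega) p1⟩
    simp only [ne_eq, Prod.mk.injEq, not_and]; omega

theorem u_triple (i j : ℤ) (hij : j = i + 1 ∨ i = j + 1) : u i * u j * u i = 0 := by
  ext f l
  simp only [Module.End.mul_apply, u_apply, LinearMap.zero_apply, Pi.zero_apply]
  refine Finset.sum_eq_zero fun p hp => Finset.sum_eq_zero fun q hq =>
    Finset.sum_eq_zero fun r hr => ?_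
  exfalso
  simp only [Finset.mem_filter, mem_corners] at hp hq hr
  obtain ⟨hp, hpc⟩ := hp
  obtain ⟨hq, hqc⟩ := hq
  obtain ⟨hr, hrc⟩ := hr
  obtain ⟨a, b⟩ := p
  obtain ⟨c, d⟩ := r
  obtain ⟨e, g⟩ := q
  obtain ⟨r1, r2, r3⟩ := hr
  rw [mem_er hq, mem_er hp] at r1 r2 r3
  simp only [cont] at hpc hqc hrc
  obtain ⟨p1, p2, p3⟩ := hp
  simp only at p1 p2 p3 r1 r2 r3
  rcases lt_trichotomy a c with h | h | h
  · exact p2 (l.up_left_mem h (by omega) r1.2.2)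
  · exact r1.2.1 (by ext <;> simp <;> omega)
  · rcases hij with hij | hij
    · refine r2 ⟨?_, ?_, l.up_left_mem h (by omega) p1⟩ <;>
      · simp only [ne_eq, Prod.mk.injEq, not_and]; omega
    · refine r3 ⟨?_, ?_, l.up_left_mem h.le (by omega) p1⟩ <;>
      · simp only [ne_eq, Prod.mk.injEq, not_and]; omega

theorem corner_swap {l : YoungDiagram} {p q : ℕ × ℕ} (hp : IsCorner l p)
    (hq : IsCorner (er l p) q) (h : cont p + 2 ≤ cont q ∨ cont q + 2 ≤ cont p) :
    IsCorner l q ∧ IsCorner (er l q) p ∧ er (er l q) p = er (er l p) q := by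
  have hq' : IsCorner l q := by
    obtain ⟨q1, q2, q3⟩ := hq
    rw [mem_er hp] at q1 q2 q3
    refine ⟨q1.2, fun h' => q2 ⟨?_, h'⟩, fun h' => q3 ⟨?_, h'⟩⟩
    · rintro rfl; simp only [cont] at h; push_cast at h; omega
    · rintro rfl; simp only [cont] at h; push_cast at h; omega
  have hp' : IsCorner (er l q) p := by
    obtain ⟨p1, p2, p3⟩ := hp
    refine ⟨(mem_er hq').2 ⟨?_, p1⟩, fun h' => p2 ((mem_er hq').1 h').2,
      fun h' => p3 ((mem_er hq').1 h').2⟩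
    rintro rfl; omega
  refine ⟨hq', hp', ?_⟩
  ext x
  rw [er_cells hp', er_cells hq', er_cells hq, er_cells hp, Finset.erase_right_comm]

theorem u_comm (i j : ℤ) (h : i + 2 ≤ j ∨ j + 2 ≤ i) : Commute (u i) (u j) := by
  show u i * u j = u j * u i
  ext f l
  simp only [Module.End.mul_apply, u_apply]
  rw [Finset.sum_comm' (s' := fun q => (corners (er l q)).filter (fun p => cont p = i))
    (t' := (corners l).filter (fun q => cont q = j))]
  · refine Finset.sum_congr rfl fun q hq => Finset.sum_congr rfl fun p hp => ?_
    simp only [Finset.mem_filter, mem_corners] at hp hq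
    rw [(corner_swap hq.1 hp.1 (by omega)).2.2]
  · intro p q
    simp only [Finset.mem_filter, mem_corners]
    constructor
    · rintro ⟨⟨hp, hpc⟩, hq, hqc⟩
      have := corner_swap hp hq (by omega)
      exact ⟨⟨this.2.1, hpc⟩, this.1, hqc⟩
    · rintro ⟨⟨hp, hpc⟩, hq, hqc⟩
      have := corner_swap hq hp (by omega)
      exact ⟨⟨this.1, hpc⟩, this.2.1, hqc⟩

/-- Total removal operator. -/
noncomputable def D : Module.End ℂ (YoungDiagram → ℂ) where
  toFun f l := ∑ p ∈ corners l, f (er l p)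
  map_add' f g := by ext l; simp [Finset.sum_add_distrib]
  map_smul' c f := by ext l; simp [Finset.mul_sum]

theorem D_apply (f : YoungDiagram → ℂ) (l : YoungDiagram) :
    D f l = ∑ p ∈ corners l, f (er l p) := rfl

/-- Content-weighted removal operator. -/
noncomputable def C : Module.End ℂ (YoungDiagram → ℂ) where
  toFun f l := ∑ p ∈ corners l, (cont p : ℂ) * f (er l p)
  map_add' f g := by ext l; simp [Finset.sum_add_distrib, mul_add]
  map_smul' c f := by ext l; simp [Finset.mul_sum, mul_left_comm]

theorem C_apply (f : YoungDiagram → ℂ) (l : YoungDiagram) :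
    C f l = ∑ p ∈ corners l, (cont p : ℂ) * f (er l p) := rfl

theorem fst_lt_card {l : YoungDiagram} {p : ℕ × ℕ} (h : p ∈ l) : p.1 < l.card := by
  have : (Finset.range (p.1 + 1)).image (fun i => (i, p.2)) ⊆ l.cells := by
    intro x hx
    simp only [Finset.mem_image, Finset.mem_range] at hx
    obtain ⟨i, hi, rfl⟩ := hx
    exact l.up_left_mem (by omega) le_rfl h
  have h2 := Finset.card_le_card this
  rw [Finset.card_image_of_injective _ (fun a b hab => (Prod.mk.inj hab).1)] at h2
  simpa using h2

theorem snd_lt_card {l : YoungDiagram} {p : ℕ × ℕ} (h : p ∈ l) : p.2 < l.card := by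
  have : (Finset.range (p.2 + 1)).image (fun i => (p.1, i)) ⊆ l.cells := by
    intro x hx
    simp only [Finset.mem_image, Finset.mem_range] at hx
    obtain ⟨i, hi, rfl⟩ := hx
    exact l.up_left_mem le_rfl (by omega) h
  have h2 := Finset.card_le_card this
  rw [Finset.card_image_of_injective _ (fun a b hab => (Prod.mk.inj hab).2)] at h2
  simpa using h2

/-- Shifted operators. -/
noncomputable def v (N : ℕ) (i : ℕ) : Module.End ℂ (YoungDiagram → ℂ) := u ((i : ℤ) - N)

/-- Agreement on small diagrams. -/
def Rel (N : ℕ) (f g : YoungDiagram → ℂ) : Prop := ∀ l : YoungDiagram, l.card ≤ N → f l = g l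

theorem sum_v (N : ℕ) (l : YoungDiagram) (hl : l.card ≤ N) (c : ℕ → ℂ) (f : YoungDiagram → ℂ) :
    ∑ i ∈ Finset.range (2 * N + 1), c i * v N i f l
      = ∑ p ∈ corners l, c (cont p + N).toNat * f (er l p) := by
  rw [← Finset.sum_fiberwise_of_maps_to (t := Finset.range (2 * N + 1))
    (g := fun p => (cont p + N).toNat)]
  · refine Finset.sum_congr rfl fun i hi => ?_
    rw [v, u_apply, Finset.mul_sum]
    have : ((corners l).filter fun p => cont p = (i : ℤ) - N)
        = (corners l).filter fun p => (cont p + N).toNat = i := by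
      refine Finset.filter_congr fun p hp => ?_
      have h1 := fst_lt_card (mem_corners.1 hp).1
      have h2 := snd_lt_card (mem_corners.1 hp).1
      simp only [cont]; omega
    rw [this]
    refine Finset.sum_congr rfl fun p hp => ?_
    rw [(Finset.mem_filter.1 hp).2]
  · intro p hp
    have h1 := fst_lt_card (mem_corners.1 hp).1
    have h2 := snd_lt_card (mem_corners.1 hp).1
    simp only [cont, Finset.mem_range]; omega

theorem S_rel (N : ℕ) {f g : YoungDiagram → ℂ} (h : Rel N f g) :
    Rel N (D f) ((∑ i ∈ Finset.range (2 * N + 1), v N i) g) := by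
  intro l hl
  have := sum_v N l hl (fun _ => 1) g
  simp only [one_mul] at this
  rw [LinearMap.sum_apply, Finset.sum_apply, this, D_apply]
  refine Finset.sum_congr rfl fun p hp => h _ ?_
  have := er_card hp
  omega

theorem T_rel (N : ℕ) {f g : YoungDiagram → ℂ} (h : Rel N f g) :
    Rel N (C f + (N : ℂ) • D f) ((∑ i ∈ Finset.range (2 * N + 1),
      (i : Module.End ℂ (YoungDiagram → ℂ)) * v N i) g) := by
  intro l hl
  have := sum_v N l hl (fun i => i) g
  have h2 : ∀ i : ℕ, ((i : Module.End ℂ (YoungDiagram → ℂ)) * v N i) g l = (i : ℂ) * v N i g l := by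
    intro i
    rw [← nsmul_eq_mul, LinearMap.smul_apply, Pi.smul_apply, nsmul_eq_mul]
  rw [LinearMap.sum_apply, Finset.sum_apply, Finset.sum_congr rfl fun i _ => h2 i, this,
    Pi.add_apply, Pi.smul_apply, C_apply, D_apply, smul_eq_mul, Finset.mul_sum,
    ← Finset.sum_add_distrib]
  refine Finset.sum_congr rfl fun p hp => ?_
  have hc := er_card hp
  have h1 := fst_lt_card (mem_corners.1 hp).1
  rw [h (er l p) (by omega), ← add_mul]
  congr 1
  have : (((cont p + N).toNat : ℤ) : ℂ) = ((cont p + N : ℤ) : ℂ) := by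
    congr 1
    apply Int.toNat_of_nonneg
    simp only [cont]; omega
  push_cast at this
  exact this.symm

theorem W_rel (N : ℕ) {f g : YoungDiagram → ℂ} (h : Rel N f g) :
    Rel N ((C * D - D * C) f) ((∑ i ∈ Finset.range (2 * N), wel (v N) i) g) := by
  have hc : ∀ i j, i + 2 ≤ j → Commute (v N i) (v N j) := fun i j hij =>
    u_comm _ _ (by omega)
  rw [← W_eq (v N) hc]
  intro l hl
  have h1 := T_rel N (S_rel N h) l hl
  have h2 := S_rel N (T_rel N h) l hl
  simp only [LinearMap.sub_apply, Module.End.mul_apply, Pi.sub_apply]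
  rw [← h1, ← h2, map_add, map_smul]
  simp only [Pi.add_apply, Pi.smul_apply]
  ring

theorem W_comm (f : YoungDiagram → ℂ) (l : YoungDiagram) :
    (C * D - D * C) (D f) l = D ((C * D - D * C) f) l := by
  have hs := serre (v l.card) (fun i j hij => u_comm _ _ (by omega)) (fun i => u_sq _)
    (fun i => u_triple _ _ (by push_cast; omega)) (fun i => u_triple _ _ (by push_cast; omega))
    (2 * l.card)
  have hr : Rel l.card f f := fun _ _ => rfl
  rw [W_rel _ (S_rel _ hr) l le_rfl, S_rel _ (W_rel _ hr) l le_rfl,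
    ← Module.End.mul_apply, hs, Module.End.mul_apply]

/-- Sum of contents. -/
noncomputable def ct (l : YoungDiagram) : ℂ := ∑ p ∈ l.cells, (cont p : ℂ)

theorem ct_er {l : YoungDiagram} {p : ℕ × ℕ} (h : p ∈ corners l) :
    ct l = ct (er l p) + cont p := by
  rw [mem_corners] at h
  rw [ct, ct, er_cells h, Finset.sum_erase_add _ _ h.1]

theorem D_congr {f g : YoungDiagram → ℂ} {l : YoungDiagram}
    (h : ∀ m : YoungDiagram, m.card + 1 = l.card → f m = g m) : D f l = D g l :=
  Finset.sum_congr rfl fun p hp => h _ (er_card hp)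

theorem C_congr {f g : YoungDiagram → ℂ} {l : YoungDiagram}
    (h : ∀ m : YoungDiagram, m.card + 1 = l.card → f m = g m) : C f l = C g l :=
  Finset.sum_congr rfl fun p hp => by rw [h _ (er_card hp)]

theorem comb (d x : YoungDiagram → ℂ)
    (hd : ∀ l : YoungDiagram, 1 ≤ l.card → d l = D d l)
    (hx : ∀ l : YoungDiagram, 3 ≤ l.card → x l = D x l)
    (h2 : ∀ l : YoungDiagram, l.card = 2 → ct l * d l = x l) (n : ℕ) :
    ∀ l : YoungDiagram, l.card = n + 2 →
      x l = (C * D - D * C) d l ∧ C d l = (n + 1) * x l ∧ ct l * d l = (n + 2).choose 2 * x l := by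
  have hE : ∀ l : YoungDiagram, 2 ≤ l.card →
      C d l = D (C d) l + (C * D - D * C) d l := by
    intro l hl
    have : C d l = C (D d) l := C_congr fun m hm => hd m (by omega)
    simp only [LinearMap.sub_apply, Module.End.mul_apply, Pi.sub_apply, ← this]
    ring
  have hct : ∀ l : YoungDiagram, 1 ≤ l.card →
      ct l * d l = D (fun m => ct m * d m) l + C d l := by
    intro l hl
    rw [hd l hl, D_apply, D_apply, C_apply, Finset.mul_sum, ← Finset.sum_add_distrib]
    refine Finset.sum_congr rfl fun p hp => ?_
    rw [ct_er hp]; ring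
  have hz : ∀ l : YoungDiagram, 3 ≤ l.card →
      (C * D - D * C) d l = D ((C * D - D * C) d) l := by
    intro l hl
    rw [← W_comm]
    simp only [LinearMap.sub_apply, Module.End.mul_apply, Pi.sub_apply]
    congr 1
    · exact C_congr fun m hm => D_congr fun k hk => hd k (by omega)
    · exact D_congr fun m hm => C_congr fun k hk => hd k (by omega)
  have hC1 : ∀ l : YoungDiagram, l.card = 1 → C d l = 0 := by
    intro l hl
    rw [C_apply]
    refine Finset.sum_eq_zero fun p hp => ?_
    have h1 := fst_lt_card (mem_corners.1 hp).1
    have h2 := snd_lt_card (mem_corners.1 hp).1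
    simp only [cont]
    have : p.1 = 0 := by omega
    have : p.2 = 0 := by omega
    simp [*]
  have hct0 : ∀ l : YoungDiagram, l.card = 0 → ct l * d l = 0 := by
    intro l hl
    simp [ct, Finset.card_eq_zero.1 hl]
  have hct1 : ∀ l : YoungDiagram, l.card = 1 → ct l * d l = 0 := by
    intro l hl
    rw [hct l (by omega), hC1 l hl, add_zero]
    exact Finset.sum_eq_zero fun p hp => hct0 _ (by have := er_card hp; omega)
  induction n with
  | zero =>
    intro l hl
    have a : C d l = x l := by
      rw [← h2 l hl, hct l (by omega)]
      symm
      convert zero_add _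
      exact Finset.sum_eq_zero fun p hp => hct1 _ (by have := er_card hp; omega)
    refine ⟨?_, by simp [a], by simp [h2 l hl]⟩
    rw [← a, hE l (by omega)]
    convert zero_add _
    exact Finset.sum_eq_zero fun p hp => hC1 _ (by have := er_card hp; omega)
  | succ n ih =>
    intro l hl
    have z : x l = (C * D - D * C) d l := by
      rw [hx l (by omega), hz l (by omega)]
      exact D_congr fun m hm => (ih m (by omega)).1
    have e : C d l = ((n + 1 : ℕ) + 1) * x l := by
      rw [hE l (by omega), ← z, D_congr (g := ((n : ℂ) + 1) • x), map_smul, Pi.smul_apply,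
        ← hx l (by omega), smul_eq_mul]
      · push_cast; ring
      · intro m hm
        exact (ih m (by omega)).2.1
    refine ⟨z, e, ?_⟩
    rw [hct l (by omega), e, D_congr (g := ((n + 2).choose 2 : ℂ) • x), map_smul, Pi.smul_apply,
        ← hx l (by omega), smul_eq_mul]
    · rw [Nat.choose_succ_succ (n + 2) 1]
      push_cast
      simp
      ring
    · intro m hm
      exact (ih m (by omega)).2.2

end Young

section Young2

theorem sum_snd (l : YoungDiagram) :
    ∑ p ∈ l.cells, (p.2 : ℂ) = ∑ i ∈ Finset.range l.card, ((l.rowLen i).choose 2 : ℂ) := by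
  rw [← Finset.sum_fiberwise_of_maps_to (t := Finset.range l.card) (g := Prod.fst)
    (fun p hp => Finset.mem_range.2 (fst_lt_card ((YoungDiagram.mem_cells p).1 hp)))]
  refine Finset.sum_congr rfl fun i _ => ?_
  have : (l.cells.filter fun p => p.1 = i) = {i} ×ˢ Finset.range (l.rowLen i) := by
    rw [← YoungDiagram.row_eq_prod]
    ext p; simp [YoungDiagram.mem_row_iff]
  rw [this, Finset.sum_product, Finset.sum_singleton, Nat.choose_two_right, ← Finset.sum_range_id]
  push_cast; rfl

theorem sum_fst (l : YoungDiagram) :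
    ∑ p ∈ l.cells, (p.1 : ℂ) = ∑ i ∈ Finset.range l.card, ((l.colLen i).choose 2 : ℂ) := by
  rw [← Finset.sum_fiberwise_of_maps_to (t := Finset.range l.card) (g := Prod.snd)
    (fun p hp => Finset.mem_range.2 (snd_lt_card ((YoungDiagram.mem_cells p).1 hp)))]
  refine Finset.sum_congr rfl fun i _ => ?_
  have : (l.cells.filter fun p => p.2 = i) = Finset.range (l.colLen i) ×ˢ {i} := by
    rw [← YoungDiagram.col_eq_prod]
    ext p; simp [YoungDiagram.mem_col_iff]
  rw [this, Finset.sum_product, Nat.choose_two_right, ← Finset.sum_range_id]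
  push_cast
  simp

theorem ct_eq (l : YoungDiagram) :
    ct l = ∑ i ∈ Finset.range l.card,
      (((l.rowLen i).choose 2 : ℂ) - ((l.colLen i).choose 2 : ℂ)) := by
  rw [Finset.sum_sub_distrib, ← sum_snd, ← sum_fst, ← Finset.sum_sub_distrib, ct]
  refine Finset.sum_congr rfl fun p _ => ?_
  simp [cont]

theorem er_le {l : YoungDiagram} {p : ℕ × ℕ} (h : p ∈ corners l) : er l p ≤ l := by
  intro x hx
  exact ((mem_er (mem_corners.1 h)).1 hx).2

theorem er_inj {l : YoungDiagram} {p q : ℕ × ℕ} (hp : p ∈ corners l) (hq : q ∈ corners l)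
    (h : er l p = er l q) : p = q := by
  by_contra hne
  rw [mem_corners] at hp hq
  have : q ∈ er l p := (mem_er hp).2 ⟨fun h => hne h.symm, hq.1⟩
  rw [h, mem_er hq] at this
  exact this.1 rfl

theorem exists_er {m l : YoungDiagram} (hle : m ≤ l) (hc : m.card + 1 = l.card) :
    ∃ p ∈ corners l, er l p = m := by
  have hsub : m.cells ⊆ l.cells := YoungDiagram.cells_subset_iff.2 hle
  have h1 : (l.cells \ m.cells).card = 1 := by
    rw [Finset.card_sdiff_of_subset hsub]
    change l.card - m.card = 1
    omega
  obtain ⟨p, hp⟩ := Finset.card_eq_one.1 h1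
  have hiff : ∀ x, (x ∈ l ∧ x ∉ m) ↔ x = p := by
    intro x
    rw [← Finset.mem_singleton, ← hp, Finset.mem_sdiff, YoungDiagram.mem_cells,
      YoungDiagram.mem_cells]
  have hpl := (hiff p).2 rfl
  have hcor : IsCorner l p := by
    obtain ⟨a, b⟩ := p
    refine ⟨hpl.1, fun h => ?_, fun h => ?_⟩
    · have : (a + 1, b) ∈ m := by
        by_contra hn
        have := (hiff _).1 ⟨h, hn⟩
        simp at this
      exact hpl.2 (m.up_left_mem (Nat.le_succ a) le_rfl this)
    · have : (a, b + 1) ∈ m := by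
        by_contra hn
        have := (hiff _).1 ⟨h, hn⟩
        simp at this
      exact hpl.2 (m.up_left_mem le_rfl (Nat.le_succ b) this)
  refine ⟨p, mem_corners.2 hcor, ?_⟩
  ext x
  rw [YoungDiagram.mem_cells, YoungDiagram.mem_cells, mem_er hcor]
  constructor
  · rintro ⟨h1, h2⟩
    by_contra h3
    exact h1 ((hiff x).1 ⟨h2, h3⟩)
  · intro h
    exact ⟨fun h' => hpl.2 (h' ▸ h), hle h⟩

end Young2

section Reps

variable {G : Type} [Group G] [Fintype G]

open scoped ComplexOrder in
theorem star_char {V : Type} [AddCommGroup V] [Module ℂ V] [FiniteDimensional ℂ V]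
    (ρ : Representation ℂ G V) (g : G) :
    (starRingEnd ℂ) (ρ.character g) = ρ.character g⁻¹ := by
  let b := Module.finBasis ℂ V
  let M : G → Matrix (Fin (Module.finrank ℂ V)) (Fin (Module.finrank ℂ V)) ℂ :=
    fun g => LinearMap.toMatrix b b (ρ g)
  have hM : ∀ a c, M (a * c) = M a * M c := fun a c => by
    simp only [M, map_mul]
    exact LinearMap.toMatrix_mul b _ _
  have h1 : M 1 = 1 := by simp only [M, map_one]; exact LinearMap.toMatrix_one b
  have htr : ∀ g, ρ.character g = (M g).trace := fun g =>
    LinearMap.trace_eq_matrix_trace ℂ b (ρ g)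
  let H := ∑ a : G, (M a).conjTranspose * M a
  have hpd : H.PosDef := by
    have : H = (M 1).conjTranspose * M 1
        + ∑ a ∈ Finset.univ.erase (1 : G), (M a).conjTranspose * M a :=
      (Finset.add_sum_erase _ _ (Finset.mem_univ 1)).symm
    rw [this, h1]
    refine Matrix.PosDef.add_posSemidef (by simpa using Matrix.PosDef.one) ?_
    exact Matrix.posSemidef_sum _ fun a _ => Matrix.posSemidef_conjTranspose_mul_self _
  have hinv : (M g).conjTranspose * H * M g = H := by
    simp only [H, Finset.mul_sum, Finset.sum_mul]
    refine Fintype.sum_equiv (Equiv.mulRight g) _ _ fun a => ?_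
    simp [hM, Matrix.conjTranspose_mul, Matrix.mul_assoc]
  have hu : IsUnit H := hpd.isUnit
  have hdet : IsUnit H.det := (Matrix.isUnit_iff_isUnit_det H).1 hu
  have e : (M g).conjTranspose = H * M g⁻¹ * H⁻¹ := by
    have : (M g).conjTranspose * H = H * M g⁻¹ := by
      conv_rhs => rw [← hinv, Matrix.mul_assoc, ← hM, mul_inv_cancel, h1, Matrix.mul_one]
    rw [← this, Matrix.mul_assoc, Matrix.mul_nonsing_inv _ hdet, Matrix.mul_one]
  rw [htr, htr, starRingEnd_apply, ← Matrix.trace_conjTranspose, e, Matrix.trace_mul_comm,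
    ← Matrix.mul_assoc, Matrix.nonsing_inv_mul _ hdet, Matrix.one_mul]

theorem star_char' (V : FDRep ℂ G) (g : G) :
    (starRingEnd ℂ) (V.character g) = V.character g⁻¹ := star_char V.ρ g

theorem char_span (n : ℕ) : ∀ (V : Type) [AddCommGroup V] [Module ℂ V] [FiniteDimensional ℂ V]
    (ρ : Representation ℂ G V), Module.finrank ℂ V = n →
    ρ.character ∈ Submodule.span ℂ {f : G → ℂ | ∃ W : FDRep ℂ G, Simple W ∧ W.character = f} := by
  induction n using Nat.strong_induction_on with
  | _ n ih =>
  intro V _ _ _ ρ hn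
  have : Invertible (Nat.card G : ℂ) := invertibleOfNonzero (NeZero.ne _)
  by_cases hirr : ρ.IsIrreducible
  · apply Submodule.subset_span
    refine ⟨FDRep.of ρ, ?_, rfl⟩
    rw [FDRep.simple_iff_char_is_norm_one]
    have := Representation.char_orthonormal ρ ρ
    rw [if_pos ⟨Representation.Equiv.refl ρ⟩, inv_mul_eq_one₀ (NeZero.ne _)] at this
    exact this.symm
  by_cases hV : Subsingleton V
  · have : ρ.character = 0 := by
      ext g
      have : ρ g = 0 := Subsingleton.elim _ _
      simp [Representation.character, this]
    rw [this]
    exact Submodule.zero_mem _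
  rw [not_subsingleton_iff_nontrivial] at hV
  obtain ⟨p, hp1, hp2⟩ : ∃ p : Subrepresentation ρ, p ≠ ⊥ ∧ p ≠ ⊤ := by
    by_contra hcon
    push Not at hcon
    apply hirr
    have : Nontrivial (Subrepresentation ρ) := by
      refine ⟨⊥, ⊤, fun h => ?_⟩
      have : (⊥ : Submodule ℂ V) = ⊤ := congrArg Subrepresentation.toSubmodule h
      exact bot_ne_top this
    exact ⟨fun a => or_iff_not_imp_left.2 (hcon a)⟩
  obtain ⟨q, hpq⟩ := exists_isCompl p
  have hc : IsCompl p.toSubmodule q.toSubmodule := by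
    constructor
    · rw [disjoint_iff, ← Subrepresentation.toSubmodule_inf, hpq.inf_eq_bot]; rfl
    · rw [codisjoint_iff, ← Subrepresentation.toSubmodule_sup, hpq.sup_eq_top]; rfl
  have hchar : ρ.character = p.toRepresentation.character + q.toRepresentation.character := by
    ext g
    let e := Submodule.prodEquivOfIsCompl _ _ hc
    have he : ρ g = e.conj (LinearMap.prodMap (p.toRepresentation g) (q.toRepresentation g)) := by
      apply LinearMap.ext
      intro x
      obtain ⟨y, rfl⟩ := e.surjective x
      rw [LinearEquiv.conj_apply_apply, LinearEquiv.symm_apply_apply]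
      obtain ⟨y1, y2⟩ := y
      simp only [e, Submodule.coe_prodEquivOfIsCompl', LinearMap.prodMap_apply, map_add]
      rfl
    rw [Pi.add_apply, Representation.character, he, LinearMap.trace_conj',
      LinearMap.trace_prodMap']
    rfl
  have hdim := Submodule.finrank_add_eq_of_isCompl hc
  have hpos1 : p.toSubmodule ≠ ⊥ := fun h => hp1 (Subrepresentation.toSubmodule_injective h)
  have hlt : p.toSubmodule < ⊤ :=
    lt_top_iff_ne_top.2 fun h => hp2 (Subrepresentation.toSubmodule_injective h)
  have l1 := Submodule.finrank_lt hlt.ne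
  have l2 : 0 < Module.finrank ℂ p.toSubmodule := by
    rw [Module.finrank_pos_iff]
    exact Submodule.nontrivial_iff_ne_bot.2 hpos1
  rw [hchar]
  exact Submodule.add_mem _ (ih _ (by omega) _ _ rfl) (ih _ (by omega) _ _ rfl)

theorem eq_zero_of_orth {ι : Type} (χ : ι → FDRep ℂ G) (hs : ∀ i, Simple (χ i))
    (hd : ∀ i j, i ≠ j → ¬ Nonempty (χ i ≅ χ j)) (f : G → ℂ)
    (hf : f ∈ Submodule.span ℂ (Set.range fun i => (χ i).character))
    (h0 : ∀ i, ∑ g : G, f g * (χ i).character g⁻¹ = 0) : f = 0 := by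
  have : Invertible (Nat.card G : ℂ) := invertibleOfNonzero (NeZero.ne _)
  obtain ⟨c, rfl⟩ := Finsupp.mem_span_range_iff_exists_finsupp.1 hf
  have ho : ∀ i j, ∑ g : G, (χ i).character g * (χ j).character g⁻¹
      = if i = j then (Nat.card G : ℂ) else 0 := by
    intro i j
    have := hs i
    have := hs j
    have h := FDRep.char_orthonormal (χ i) (χ j)
    split_ifs with hij
    · subst hij
      rw [if_pos ⟨Iso.refl _⟩, inv_mul_eq_one₀ (NeZero.ne _)] at h
      exact h.symm
    · rw [if_neg (hd i j hij)] at h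
      simpa using h
  have hc : ∀ j, c j = 0 := by
    intro j
    have h := h0 j
    simp only [Finsupp.sum, Finset.sum_apply, Pi.smul_apply, smul_eq_mul, Finset.sum_mul] at h
    rw [Finset.sum_comm] at h
    simp only [mul_assoc, ← Finset.mul_sum, ho] at h
    simpa using h
  have : c = 0 := Finsupp.ext hc
  simp [this]

end Reps

section Main

/-- Standard transposition. -/
def tau (n : ℕ) : Perm (Fin n) :=
  if h : 2 ≤ n then Equiv.swap ⟨0, by omega⟩ ⟨1, by omega⟩ else 1

theorem via_tau (n : ℕ) (hn : 2 ≤ n) :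
    Perm.viaEmbeddingHom Fin.castSuccEmb (tau n) = tau (n + 1) := by
  rw [Perm.viaEmbeddingHom_apply]
  ext x
  simp only [tau, dif_pos hn, dif_pos (show 2 ≤ n + 1 by omega)]
  refine Fin.lastCases ?_ (fun y => ?_) x
  · rw [Perm.viaEmbedding_apply_of_notMem]
    · rw [Equiv.swap_apply_of_ne_of_ne]
      · simp [Fin.ext_iff]; omega
      · simp [Fin.ext_iff]; omega
    · rintro ⟨y, hy⟩
      exact (Fin.castSucc_lt_last y).ne hy
  · have : Fin.castSucc y = Fin.castSuccEmb y := rfl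
    rw [this, Perm.viaEmbedding_apply]
    simp only [Fin.coe_castSuccEmb, Equiv.swap_apply_def, Fin.ext_iff]
    split_ifs <;> simp_all

variable (ρ : ∀ n : ℕ, ∀ μ : YoungDiagram, μ.card = n → FDRep ℂ (Perm (Fin n)))

/-- Total version of the character. -/
noncomputable def X (n : ℕ) (μ : YoungDiagram) (g : Perm (Fin n)) : ℂ :=
  if h : μ.card = n then (ρ n μ h).character g else 0

theorem X_eq (n : ℕ) (μ : YoungDiagram) (h : μ.card = n) (g : Perm (Fin n)) :
    X ρ n μ g = (ρ n μ h).character g := dif_pos h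

theorem restr
    (hsimple : ∀ n μ hμ, Simple (ρ n μ hμ))
    (hdistinct : ∀ n μ lam hμ hlam, μ ≠ lam → ¬ Nonempty (ρ n μ hμ ≅ ρ n lam hlam))
    (hcomplete : ∀ n, ∀ V : FDRep ℂ (Perm (Fin n)), Simple V →
      ∃ μ hμ, Nonempty (ρ n μ hμ ≅ V))
    (hbranch : ∀ n μ lam (hμ : YoungDiagram.card μ = n)
        (hlam : YoungDiagram.card lam = n + 1),
      (∑ g : Perm (Fin n),
          (ρ (n + 1) lam hlam).character (Perm.viaEmbeddingHom Fin.castSuccEmb g) *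
            (starRingEnd ℂ) ((ρ n μ hμ).character g)) /
          (Fintype.card (Perm (Fin n)) : ℂ) =
        if μ ≤ lam then 1 else 0)
    (n : ℕ) (l : YoungDiagram) (hl : l.card = n + 1) (g : Perm (Fin n)) :
    X ρ (n + 1) l (Perm.viaEmbeddingHom Fin.castSuccEmb g) = ∑ p ∈ corners l, X ρ n (er l p) g := by
  let χ : {μ : YoungDiagram // μ.card = n} → FDRep ℂ (Perm (Fin n)) := fun μ => ρ n μ.1 μ.2
  have hspan : ∀ V : FDRep ℂ (Perm (Fin n)),
      V.character ∈ Submodule.span ℂ (Set.range fun i => (χ i).character) := by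
    intro V
    have h := char_span _ V V.ρ rfl
    refine (Submodule.span_mono ?_) h
    rintro f ⟨W, hW, rfl⟩
    obtain ⟨μ, hμ, ⟨i⟩⟩ := hcomplete n W hW
    exact ⟨⟨μ, hμ⟩, FDRep.char_iso i⟩
  have hcard : ∀ p ∈ corners l, (er l p).card = n := fun p hp => by
    have := er_card hp; omega
  let φ : Perm (Fin n) →* Perm (Fin (n + 1)) := Perm.viaEmbeddingHom Fin.castSuccEmb
  have hres : (fun g => X ρ (n + 1) l (φ g))
      ∈ Submodule.span ℂ (Set.range fun i => (χ i).character) := by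
    have h := hspan (FDRep.of ((ρ (n + 1) l hl).ρ.comp φ))
    convert h using 1
    ext g
    rw [X_eq ρ _ _ hl]
    rfl
  have hX : ∀ p ∈ corners l, X ρ n (er l p)
      ∈ Submodule.span ℂ (Set.range fun i => (χ i).character) := by
    intro p hp
    have : X ρ n (er l p) = (ρ n (er l p) (hcard p hp)).character := by
      ext g; exact X_eq _ _ _ _ _
    rw [this]
    exact hspan _
  have hN : (Fintype.card (Perm (Fin n)) : ℂ) ≠ 0 := Nat.cast_ne_zero.2 Fintype.card_ne_zero
  have key := eq_zero_of_orth χ (fun i => hsimple _ _ _)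
    (fun i j hij => hdistinct _ _ _ _ _ fun h => hij (Subtype.ext h))
    ((fun g => X ρ (n + 1) l (φ g)) - ∑ p ∈ corners l, X ρ n (er l p))
    (Submodule.sub_mem _ hres (Submodule.sum_mem _ hX)) ?_
  · have := congrFun key g
    simp only [Pi.sub_apply, Finset.sum_apply, Pi.zero_apply] at this
    exact sub_eq_zero.1 this
  · rintro ⟨μ, hμ⟩
    have hb := hbranch n μ l hμ hl
    rw [div_eq_iff hN] at hb
    simp only [star_char'] at hb
    simp only [Pi.sub_apply, Finset.sum_apply, sub_mul, Finset.sum_sub_distrib, Finset.sum_mul, χ]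
    rw [Finset.sum_comm]
    have ho : ∀ p ∈ corners l, ∑ g, X ρ n (er l p) g * (ρ n μ hμ).character g⁻¹
        = if er l p = μ then (Fintype.card (Perm (Fin n)) : ℂ) else 0 := by
      intro p hp
      have : Invertible (Nat.card (Perm (Fin n)) : ℂ) := invertibleOfNonzero (NeZero.ne _)
      have := hsimple n (er l p) (hcard p hp)
      have := hsimple n μ hμ
      have h := FDRep.char_orthonormal (ρ n (er l p) (hcard p hp)) (ρ n μ hμ)
      simp only [X_eq ρ n _ (hcard p hp)]
      split_ifs with hij
      · subst hij
        rw [if_pos ⟨Iso.refl _⟩, inv_mul_eq_one₀ (NeZero.ne _)] at h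
        rw [← h, Nat.card_eq_fintype_card]
      · rw [if_neg (hdistinct _ _ _ _ _ hij)] at h
        simpa [hN] using h
    rw [Finset.sum_congr rfl ho]
    simp only [X_eq ρ _ _ hl, φ]
    rw [hb]
    by_cases hle : μ ≤ l
    · obtain ⟨p, hp, rfl⟩ := exists_er hle (by omega)
      rw [if_pos hle, Finset.sum_eq_single_of_mem p hp, if_pos rfl]
      · ring
      · intro q hq hne
        rw [if_neg fun h => hne (er_inj hq hp h)]
    · rw [if_neg hle, Finset.sum_eq_zero]
      · ring
      · intro p hp
        rw [if_neg]
        rintro rfl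
        exact hle (er_le hp)

/-- The one-row diagram with two cells. -/
def row2 : YoungDiagram := ⟨{(0, 0), (0, 1)}, by
  rintro ⟨a, b⟩ ⟨c, d⟩ hle hm
  have hle' : c ≤ a ∧ d ≤ b := hle
  simp only [Finset.coe_insert, Finset.coe_singleton, Set.mem_insert_iff, Prod.mk.injEq,
    Set.mem_singleton_iff] at hm ⊢
  omega⟩

theorem mem_row2 (p : ℕ × ℕ) : p ∈ row2 ↔ p = (0, 0) ∨ p = (0, 1) := by
  rw [← YoungDiagram.mem_cells]; simp [row2]

theorem row2_card : row2.card = 2 := rfl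

theorem row2_rowLen : row2.rowLen 0 = 2 := by
  have h1 : 1 < row2.rowLen 0 := YoungDiagram.mem_iff_lt_rowLen.1 ((mem_row2 _).2 (by simp))
  have h2 : ¬ 2 < row2.rowLen 0 := fun h => by
    have := (mem_row2 _).1 (YoungDiagram.mem_iff_lt_rowLen.2 h)
    simp at this
  omega

theorem card_two (l : YoungDiagram) (hl : l.card = 2) :
    l = row2 ∨ l.cells = {(0, 0), (1, 0)} := by
  by_cases h : (0, 1) ∈ l
  · left
    have h0 : (0, 0) ∈ l := l.up_left_mem le_rfl (by omega) h
    have : row2.cells = l.cells := by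
      refine Finset.eq_of_subset_of_card_le ?_ (by rw [show l.cells.card = 2 from hl]; rfl)
      intro p hp
      rcases (mem_row2 p).1 hp with rfl | rfl <;> assumption
    ext p
    rw [this]
  · right
    refine Finset.eq_of_subset_of_card_le ?_ (by rw [show l.cells.card = 2 from hl]; rfl)
    rintro ⟨a, b⟩ hp
    have h1 := fst_lt_card hp
    have h2 := snd_lt_card hp
    simp only at h1 h2
    have hb : b = 0 := by
      by_contra hb
      exact h (l.up_left_mem (Nat.zero_le _) (by omega) hp)
    simp only [Finset.mem_insert, Prod.mk.injEq, Finset.mem_singleton]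
    omega

end Main

end FrobRatio

open FrobRatio in

/-- Frobenius' formula for the character ratio of the symmetric group on a transposition.
Here the irreducible representations of the symmetric groups are encoded by any family
`ρ n μ _ : FDRep ℂ (Perm (Fin n))`, indexed by Young diagrams `μ` with `n` cells, which are
irreducible, pairwise non-isomorphic, exhaustive, satisfy the Young branching rule with
respect to the standard inclusions `Perm (Fin n) ↪ Perm (Fin (n+1))` (the multiplicity
`⟨χ^{ρ λ}|_{S_n}, χ^{ρ μ}⟩` is `1` if `μ ⊆ λ` and `0` otherwise), and assign the trivial
representation to one-row diagrams.  (Specht modules form such a family, and these conditions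
determine it.)  Then for `n ≥ 2`, a Young diagram `λ` with `n` cells, and any transposition
`t` in `Perm (Fin n)`,
`χ^λ(t)/dim(λ) = (1/C(n,2)) · Σ_i (C(λ_i,2) − C(λ'_i,2))`,
where `λ_i` and `λ'_i` are the row and column lengths of `λ`. -/
theorem frobenius_character_ratio_transposition
    (ρ : ∀ n : ℕ, ∀ μ : YoungDiagram, μ.card = n → FDRep ℂ (Perm (Fin n)))
    (hsimple : ∀ n μ hμ, Simple (ρ n μ hμ))
    (hdistinct : ∀ n μ lam hμ hlam, μ ≠ lam → ¬ Nonempty (ρ n μ hμ ≅ ρ n lam hlam))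
    (hcomplete : ∀ n, ∀ V : FDRep ℂ (Perm (Fin n)), Simple V →
      ∃ μ hμ, Nonempty (ρ n μ hμ ≅ V))
    (hbranch : ∀ n μ lam (hμ : YoungDiagram.card μ = n)
        (hlam : YoungDiagram.card lam = n + 1),
      (∑ g : Perm (Fin n),
          (ρ (n + 1) lam hlam).character (Perm.viaEmbeddingHom Fin.castSuccEmb g) *
            (starRingEnd ℂ) ((ρ n μ hμ).character g)) /
          (Fintype.card (Perm (Fin n)) : ℂ) =
        if μ ≤ lam then 1 else 0)
    (htrivial : ∀ n μ (hμ : YoungDiagram.card μ = n), μ.rowLen 0 = n →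
      ∀ g : Perm (Fin n), (ρ n μ hμ).character g = 1) :
    ∀ n : ℕ, 2 ≤ n → ∀ lam (hlam : YoungDiagram.card lam = n),
      ∀ t : Perm (Fin n), t.IsSwap →
      (ρ n lam hlam).character t / (Module.finrank ℂ (ρ n lam hlam) : ℂ) =
        (1 / (n.choose 2 : ℂ)) *
          ∑ i ∈ Finset.range n,
            (((lam.rowLen i).choose 2 : ℂ) - ((lam.colLen i).choose 2 : ℂ)) := by
  have hr := restr ρ hsimple hdistinct hcomplete hbranch
  let d : YoungDiagram → ℂ := fun l => X ρ l.card l 1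
  let x : YoungDiagram → ℂ := fun l => X ρ l.card l (tau l.card)
  have hd : ∀ l : YoungDiagram, 1 ≤ l.card → d l = D d l := by
    intro l hl
    obtain ⟨n, hn⟩ : ∃ n, l.card = n + 1 := ⟨l.card - 1, by omega⟩
    have h := hr n l hn 1
    rw [map_one] at h
    simp only [d, D_apply]
    rw [hn, h]
    refine Finset.sum_congr rfl fun p hp => ?_
    have : (er l p).card = n := by have := er_card hp; omega
    rw [this]
  have hx : ∀ l : YoungDiagram, 3 ≤ l.card → x l = D x l := by
    intro l hl
    obtain ⟨n, hn⟩ : ∃ n, l.card = n + 1 := ⟨l.card - 1, by omega⟩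
    have h := hr n l hn (tau n)
    rw [via_tau n (by omega)] at h
    simp only [x, D_apply]
    rw [hn, h]
    refine Finset.sum_congr rfl fun p hp => ?_
    have : (er l p).card = n := by have := er_card hp; omega
    rw [this]
  have h2 : ∀ l : YoungDiagram, l.card = 2 → ct l * d l = x l := by
    intro l hl
    have hd1 : ∀ m : YoungDiagram, m.card = 1 → d m = 1 := by
      intro m hm
      have hrow : m.rowLen 0 = 1 := by
        obtain ⟨p, hp⟩ := Finset.card_pos.1 (show 0 < m.cells.card by
          rw [show m.cells.card = 1 from hm]; omega)
        have h00 : (0, 0) ∈ m := m.up_left_mem (Nat.zero_le _) (Nat.zero_le _) hp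
        have a := YoungDiagram.mem_iff_lt_rowLen.1 h00
        have b : ¬ 1 < m.rowLen 0 := fun h => by
          have := snd_lt_card (YoungDiagram.mem_iff_lt_rowLen.2 h)
          simp only at this
          omega
        omega
      simp only [d]
      rw [hm, X_eq ρ 1 m hm]
      exact htrivial 1 m hm hrow 1
    rcases card_two l hl with rfl | hcol
    · have ht := htrivial 2 row2 row2_card row2_rowLen
      have hct : ct row2 = 1 := by simp [ct, row2, cont]
      have e1 : d row2 = 1 := by
        simp only [d]
        rw [X_eq ρ row2.card row2 rfl]
        exact ht 1
      have e2 : x row2 = 1 := by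
        simp only [x]
        rw [X_eq ρ row2.card row2 rfl]
        exact ht _
      rw [hct, e1, e2, one_mul]
    · have hct : ct l = -1 := by
        rw [ct, hcol]; simp [cont]
      have hmem : ∀ p, p ∈ l ↔ p = (0, 0) ∨ p = (1, 0) := fun p => by
        rw [← YoungDiagram.mem_cells, hcol]; simp
      have hcor : corners l = {(1, 0)} := by
        ext p
        rw [mem_corners, Finset.mem_singleton]
        constructor
        · rintro ⟨h1, h2, h3⟩
          rcases (hmem p).1 h1 with rfl | rfl
          · exact absurd ((hmem _).2 (by simp)) h2
          · rfl
        · rintro rfl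
          refine ⟨(hmem _).2 (by simp), ?_, ?_⟩ <;> rw [hmem] <;> simp
      have e1 : d l = 1 := by
        rw [hd l (by omega), D_apply, hcor, Finset.sum_singleton]
        apply hd1
        have := er_card (l := l) (p := (1, 0)) (by simp [hcor])
        omega
      have hne : l ≠ row2 := by
        rintro rfl
        have := (hmem (0, 1)).1 ((mem_row2 _).2 (by simp))
        simp at this
      have e2 : x l = -1 := by
        have : Invertible (Nat.card (Perm (Fin 2)) : ℂ) := invertibleOfNonzero (NeZero.ne _)
        have := hsimple 2 l hl
        have := hsimple 2 row2 row2_card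
        have h := FDRep.char_orthonormal (ρ 2 l hl) (ρ 2 row2 row2_card)
        rw [if_neg (hdistinct _ _ _ _ _ hne)] at h
        simp only [htrivial 2 row2 row2_card row2_rowLen, mul_one] at h
        have hsum : ∑ g : Perm (Fin 2), (ρ 2 l hl).character g = 0 := by
          rcases mul_eq_zero.1 h with h | h
          · exact absurd h (inv_ne_zero (NeZero.ne _))
          · exact h
        have huniv : (Finset.univ : Finset (Perm (Fin 2))) = {1, Equiv.swap 0 1} := by decide
        rw [huniv, Finset.sum_pair (by decide)] at hsum
        simp only [d, x] at e1 ⊢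
        rw [hl, X_eq ρ 2 l hl] at e1 ⊢
        rw [e1] at hsum
        have ht : tau 2 = Equiv.swap 0 1 := by simp [tau]
        rw [ht]
        linear_combination hsum
      rw [hct, e1, e2, mul_one]
  intro n hn lam hlam t ht
  subst hlam
  obtain ⟨k, hk⟩ : ∃ k, lam.card = k + 2 := ⟨lam.card - 2, by omega⟩
  have hmain := (comb d x hd hx h2 k lam hk).2.2
  rw [← hk] at hmain
  have hxt : (ρ lam.card lam rfl).character t = x lam := by
    simp only [x]
    rw [X_eq ρ _ _ rfl]
    have hs : (tau lam.card).IsSwap := by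
      rw [tau, dif_pos hn]
      exact ⟨_, _, by simp [Fin.ext_iff], rfl⟩
    have hconj : IsConj (tau lam.card) t := by
      rw [Perm.isConj_iff_cycleType_eq, Perm.isSwap_iff_cycleType.1 hs, Perm.isSwap_iff_cycleType.1 ht]
    obtain ⟨c, hc⟩ := isConj_iff.1 hconj
    rw [← hc, FDRep.char_conj]
  have hdd : (Module.finrank ℂ (ρ lam.card lam rfl) : ℂ) = d lam := by
    simp only [d]
    rw [X_eq ρ _ _ rfl, FDRep.char_one]
  have hd0 : d lam ≠ 0 := by
    rw [← hdd, Nat.cast_ne_zero]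
    intro h0
    have hsm := hsimple lam.card lam rfl
    rw [FDRep.simple_iff_char_is_norm_one] at hsm
    have : ∀ g, (ρ lam.card lam rfl).character g = 0 := by
      intro g
      have : Subsingleton (ρ lam.card lam rfl) := Module.finrank_zero_iff.1 h0
      have h1 : (ρ lam.card lam rfl).ρ g = 0 := LinearMap.ext fun v => Subsingleton.elim _ _
      rw [FDRep.character, h1, map_zero]
    simp only [this, mul_zero, Finset.sum_const_zero] at hsm
    exact (NeZero.ne (Nat.card (Perm (Fin lam.card)) : ℂ)) hsm.symm
  have hch : (lam.card.choose 2 : ℂ) ≠ 0 :=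
    Nat.cast_ne_zero.2 (Nat.choose_pos hn).ne'
  rw [hxt, hdd, ← ct_eq, div_eq_iff hd0, one_div, mul_assoc, hmain, inv_mul_cancel_left₀ hch]
end

section
/- Let T be a uniformly random standard Young tableau of shape λ, a partition of n. Then the expected value of the content of the box of T containing the entry j is (j−1)/C(n,2) · Σ_{x∈λ} c(x). -/
/-- The total content of a Young diagram: the sum of `j − i` over the boxes `(i,j)`. -/
def YoungDiagram.contentSum (μ : YoungDiagram) : ℤ :=
  ∑ x ∈ μ.cells, ((x.2 : ℤ) - (x.1 : ℤ))

/-- Standard Young tableaux of shape `μ`, encoded as maximal chains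
`⊥ = c 0 ⊆ c 1 ⊆ ⋯ ⊆ c |μ| = μ` of Young diagrams (the box containing the entry `j` is the
box added at step `j`). -/
def SytChain (μ : YoungDiagram) : Type :=
  {c : Fin (μ.card + 1) → YoungDiagram //
    c 0 = ⊥ ∧ c (Fin.last μ.card) = μ ∧
    ∀ i : Fin μ.card, c i.castSucc ≤ c i.succ ∧ (c i.succ).card = (c i.castSucc).card + 1}

open Finset

namespace SytAux

/-- `x` is a removable box. -/
def Corner (s : Finset (ℕ × ℕ)) (x : ℕ × ℕ) : Prop := x ∈ s ∧ ∀ y ∈ s, x ≤ y → y = x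

open Classical in
/-- Remove a corner. -/
noncomputable def er (lam : YoungDiagram) (x : ℕ × ℕ) : YoungDiagram :=
  if h : Corner lam.cells x then
    { cells := lam.cells.erase x
      isLowerSet := by
        intro a b hba ha
        simp only [coe_erase, Set.mem_sdiff, mem_coe, Set.mem_singleton_iff] at ha ⊢
        refine ⟨lam.isLowerSet hba ha.1, ?_⟩
        rintro rfl
        exact ha.2 (h.2 a ha.1 hba) }
  else lam

lemma er_cells {lam : YoungDiagram} {x : ℕ × ℕ} (h : Corner lam.cells x) :
    (er lam x).cells = lam.cells.erase x := by
  simp [er, h]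

open Classical in
/-- The down operator. -/
noncomputable def D : (YoungDiagram → ℚ) →ₗ[ℚ] (YoungDiagram → ℚ) where
  toFun g lam := ∑ x ∈ lam.cells, if Corner lam.cells x then g (er lam x) else 0
  map_add' g h := by
    ext lam
    simp only [Pi.add_apply, ← sum_add_distrib]
    refine sum_congr rfl fun x _ => ?_
    split_ifs <;> simp
  map_smul' r g := by
    ext lam
    simp [mul_sum]

/-- Multiplication by the content sum. -/
def M (g : YoungDiagram → ℚ) : YoungDiagram → ℚ := fun lam => (lam.contentSum : ℚ) * g lam

/-- content -/
def ct (x : ℕ × ℕ) : ℚ := (x.2 : ℚ) - x.1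

lemma content_er {lam : YoungDiagram} {x : ℕ × ℕ} (h : Corner lam.cells x) :
    ((er lam x).contentSum : ℚ) = lam.contentSum - ct x := by
  unfold YoungDiagram.contentSum
  rw [er_cells h, ← Finset.sum_erase_add _ _ h.1]
  simp [ct]

open Classical in
/-- Indicator of valid order of deletion. -/
noncomputable def P (s : Finset (ℕ × ℕ)) (x y z : ℕ × ℕ) : Prop :=
  Corner s x ∧ Corner (s.erase x) y ∧ Corner ((s.erase x).erase y) z

/-- extension of functions to finsets -/
noncomputable def ext (g : YoungDiagram → ℚ) (s : Finset (ℕ × ℕ)) : ℚ :=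
  open Classical in if h : ∃ mu : YoungDiagram, mu.cells = s then g h.choose else 0

lemma ext_cells (g : YoungDiagram → ℚ) (mu : YoungDiagram) : ext g mu.cells = g mu := by
  have h : ∃ nu : YoungDiagram, nu.cells = mu.cells := ⟨mu, rfl⟩
  rw [ext, dif_pos h]
  congr 1
  exact YoungDiagram.ext h.choose_spec

open Classical in
lemma sum_guard {s : Finset (ℕ × ℕ)} {x : ℕ × ℕ} (f : ℕ × ℕ → ℚ)
    (hf : ∀ y, f y ≠ 0 → y ≠ x) : ∑ y ∈ s.erase x, f y = ∑ y ∈ s, f y := by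
  apply sum_subset (erase_subset _ _)
  intro y hy hy'
  by_contra h
  exact hy' (mem_erase.2 ⟨hf y h, hy⟩)

open Classical in
lemma triple (g : YoungDiagram → ℚ) (lam : YoungDiagram) :
    M (D (D (D g))) lam - 3 * D (M (D (D g))) lam + 3 * D (D (M (D g))) lam - D (D (D (M g))) lam
    = ∑ x ∈ lam.cells, ∑ y ∈ lam.cells, ∑ z ∈ lam.cells,
      if P lam.cells x y z then
        (ct x - 2 * ct y + ct z) * ext g (((lam.cells.erase x).erase y).erase z) else 0 := by
  simp only [M, D, LinearMap.coe_mk, AddHom.coe_mk, mul_sum, ← sum_sub_distrib, ← sum_add_distrib]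
  refine sum_congr rfl fun x hx => ?_
  by_cases h1 : Corner lam.cells x
  swap
  · simp [h1, P]
  simp only [h1, if_true, mul_sum, ← sum_sub_distrib, ← sum_add_distrib]
  rw [er_cells h1]
  refine Eq.trans ?_ (sum_guard (x := x) _ ?_)
  swap
  · intro y hy
    contrapose! hy
    subst hy
    apply sum_eq_zero
    intro z _
    apply if_neg
    intro h
    simpa using h.2.1.1
  refine sum_congr rfl fun y hy => ?_
  have e1 := er_cells h1
  by_cases h2 : Corner (lam.cells.erase x) y
  swap
  · simp [h2, P]
  have h2' : Corner (er lam x).cells y := by rwa [e1]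
  have e2 := er_cells h2'
  simp only [h2, if_true, mul_sum, ← sum_sub_distrib, ← sum_add_distrib]
  rw [e2, e1]
  refine Eq.trans (Eq.trans ?_ (sum_guard (x := y) _ ?_)) (sum_guard (x := x) _ ?_)
  rotate_left
  · intro z hz
    contrapose! hz
    subst hz
    refine if_neg ?_
    intro h
    simpa using h.2.2.1
  · intro z hz
    contrapose! hz
    subst hz
    refine if_neg ?_
    intro h
    simpa using h.2.2.1
  refine sum_congr rfl fun z hz => ?_
  by_cases h3 : Corner ((lam.cells.erase x).erase y) z
  swap
  · simp [h3, P]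
  have h3' : Corner (er (er lam x) y).cells z := by rwa [e2, e1]
  have e3 := er_cells h3'
  rw [if_pos (show P lam.cells x y z from ⟨h1, h2, h3⟩)]
  simp only [h3, if_true]
  rw [← e1, ← e2, ← e3, ext_cells, content_er h3', content_er h2', content_er h1]
  ring

/-- Facts about triples -/
lemma P_iff {s : Finset (ℕ × ℕ)} {x y z : ℕ × ℕ} :
    P s x y z ↔ x ∈ s ∧ y ∈ s ∧ z ∈ s ∧ x ≠ y ∧ x ≠ z ∧ y ≠ z ∧
      (∀ w ∈ s, x ≤ w ∨ y ≤ w ∨ z ≤ w → w = x ∨ w = y ∨ w = z) ∧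
      ¬ x ≤ y ∧ ¬ x ≤ z ∧ ¬ y ≤ z := by
  simp only [P, Corner, mem_erase]
  constructor
  · rintro ⟨⟨hx, h1⟩, ⟨⟨hyx, hy⟩, h2⟩, ⟨hzy, hzx, hz⟩, h3⟩
    refine ⟨hx, hy, hz, hyx.symm, hzx.symm, hzy.symm, ?_, ?_, ?_, ?_⟩
    · intro w hw h
      by_contra! hc
      rcases h with h | h | h
      · exact hc.1 (h1 w hw h)
      · exact hc.2.1 (h2 w ⟨hc.1, hw⟩ h)
      · exact hc.2.2 (h3 w ⟨hc.2.1, hc.1, hw⟩ h)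
    · exact fun h => hyx (h1 y hy h)
    · exact fun h => hzx (h1 z hz h)
    · exact fun h => hzy (h2 z ⟨hzx, hz⟩ h)
  · rintro ⟨hx, hy, hz, hxy, hxz, hyz, hw, n1, n2, n3⟩
    refine ⟨⟨hx, ?_⟩, ⟨⟨hxy.symm, hy⟩, ?_⟩, ⟨hyz.symm, hxz.symm, hz⟩, ?_⟩
    · intro w h1 h2
      rcases hw w h1 (.inl h2) with rfl | rfl | rfl
      · rfl
      · exact absurd h2 n1
      · exact absurd h2 n2
    · rintro w ⟨h0, h1⟩ h2
      rcases hw w h1 (.inr (.inl h2)) with rfl | rfl | rfl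
      · exact absurd rfl h0
      · rfl
      · exact absurd h2 n3
    · rintro w ⟨h0, h0', h1⟩ h2
      rcases hw w h1 (.inr (.inr h2)) with rfl | rfl | rfl
      · exact absurd rfl h0'
      · exact absurd rfl h0
      · rfl

/-- convex triples -/
def Conv (x y z : ℕ × ℕ) : Prop := ∀ a b : ℕ, (x ≤ (a,b) ∨ y ≤ (a,b) ∨ z ≤ (a,b)) →
  ((a,b) ≤ x ∨ (a,b) ≤ y ∨ (a,b) ≤ z) → ((a,b) = x ∨ (a,b) = y ∨ (a,b) = z)

lemma conv_chain {x y z : ℕ × ℕ} (h : Conv x y z) (hxy : x ≠ y) (hyz : y ≠ z)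
    (h1 : z ≤ y) (h2 : y ≤ x) : ct x - 2 * ct y + ct z = 0 := by
  obtain ⟨x1, x2⟩ := x
  obtain ⟨y1, y2⟩ := y
  obtain ⟨z1, z2⟩ := z
  have a1 := h z1 x2
  have a2 := h x1 z2
  have a3 := h (z1+1) z2
  have a4 := h z1 (z2+1)
  have a5 := h (y1+1) y2
  have a6 := h y1 (y2+1)
  clear h
  simp only [ct, Prod.mk_le_mk, ne_eq, Prod.mk.injEq] at *
  have : (x2:ℤ) - x1 - 2 * (y2 - y1) + (z2 - z1) = 0 := by omega
  exact_mod_cast this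

lemma conv_V {x y z : ℕ × ℕ} (h : Conv x y z) 
    (h1 : z ≤ y) (h2 : z ≤ x) (h3 : ¬ x ≤ y) (h4 : ¬ y ≤ x) : ct x + ct y - 2 * ct z = 0 := by
  obtain ⟨x1, x2⟩ := x
  obtain ⟨y1, y2⟩ := y
  obtain ⟨z1, z2⟩ := z
  have a1 := h z1 x2
  have a2 := h x1 z2
  have a3 := h (z1+1) z2
  have a4 := h z1 (z2+1)
  have a5 := h z1 y2
  have a6 := h y1 z2
  clear h
  simp only [ct, Prod.mk_le_mk, ne_eq, Prod.mk.injEq] at *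
  have : (x2:ℤ) - x1 + (y2 - y1) - 2 * (z2 - z1) = 0 := by omega
  exact_mod_cast this

lemma conv_L {x y z : ℕ × ℕ} (h : Conv x y z) 
    (h1 : y ≤ x) (h2 : z ≤ x) (h3 : ¬ y ≤ z) (h4 : ¬ z ≤ y) : ct y + ct z - 2 * ct x = 0 := by
  obtain ⟨x1, x2⟩ := x
  obtain ⟨y1, y2⟩ := y
  obtain ⟨z1, z2⟩ := z
  have a1 := h z1 x2
  have a2 := h x1 z2
  have a3 := h (z1+1) z2
  have a4 := h z1 (z2+1)
  have a7 := h (y1+1) y2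
  have a8 := h y1 (y2+1)
  have a5 := h x1 y2
  have a6 := h y1 x2
  clear h
  simp only [ct, Prod.mk_le_mk, ne_eq, Prod.mk.injEq] at *
  have : (y2:ℤ) - y1 + (z2 - z1) - 2 * (x2 - x1) = 0 := by omega
  exact_mod_cast this

lemma conv_of {lam : YoungDiagram} {x y z : ℕ × ℕ} (h : P lam.cells x y z) : Conv x y z := by
  rw [P_iff] at h
  obtain ⟨hx, hy, hz, -, -, -, hw, -⟩ := h
  intro a b h1 h2
  refine hw _ ?_ h1
  rcases h2 with h2 | h2 | h2
  · exact lam.isLowerSet h2 hx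
  · exact lam.isLowerSet h2 hy
  · exact lam.isLowerSet h2 hz

open Classical in
/-- the summand -/
noncomputable def Q (s : Finset (ℕ × ℕ)) (x y z : ℕ × ℕ) : ℚ :=
  if P s x y z then ct x - 2 * ct y + ct z else 0

/-- symmetrised summand -/
noncomputable def S6 (s : Finset (ℕ × ℕ)) (x y z : ℕ × ℕ) : ℚ :=
  Q s x y z + Q s x z y + Q s y x z + Q s y z x + Q s z x y + Q s z y x

lemma S6_of_P {lam : YoungDiagram} {x y z : ℕ × ℕ} (h : P lam.cells x y z) :
    S6 lam.cells x y z = 0 := by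
  classical
  have hc := conv_of h
  rw [P_iff] at h
  obtain ⟨hx, hy, hz, hxy, hxz, hyz, hw, n1, n2, n3⟩ := h
  have key : ∀ a b c : ℕ × ℕ, a ∈ lam.cells → b ∈ lam.cells → c ∈ lam.cells → a ≠ b → a ≠ c →
      b ≠ c → (∀ w, w = a ∨ w = b ∨ w = c ↔ w = x ∨ w = y ∨ w = z) →
      (∀ w, a ≤ w ∨ b ≤ w ∨ c ≤ w ↔ x ≤ w ∨ y ≤ w ∨ z ≤ w) →
      Q lam.cells a b c = if ¬ a ≤ b ∧ ¬ a ≤ c ∧ ¬ b ≤ c then ct a - 2 * ct b + ct c else 0 := by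
    intro a b c ha hb hc hab hac hbc h1 h2
    unfold Q
    congr 1
    rw [P_iff]
    simp only [ha, hb, hc, hab, hac, hbc, ne_eq, not_false_eq_true, true_and, h1, h2]
    exact propext ⟨fun h => h.2, fun h => ⟨hw, h⟩⟩
  unfold S6
  rw [key x y z hx hy hz hxy hxz hyz (by tauto) (by tauto),
    key x z y hx hz hy hxz hxy hyz.symm (by tauto) (by tauto),
    key y x z hy hx hz hxy.symm hyz hxz (by tauto) (by tauto),
    key y z x hy hz hx hyz hxy.symm hxz.symm (by tauto) (by tauto),
    key z x y hz hx hy hxz.symm hyz.symm hxy (by tauto) (by tauto),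
    key z y x hz hy hx hyz.symm hxz.symm hxy.symm (by tauto) (by tauto)]
  by_cases c1 : y ≤ x <;> by_cases c2 : z ≤ x <;> by_cases c3 : z ≤ y
  · have := conv_chain hc hxy hyz c3 c1
    simp only [n1, n2, n3, c1, c2, c3]; simp; linarith
  · have := conv_L hc c1 c2 n3 c3
    simp only [n1, n2, n3, c1, c2, c3]; simp; linarith
  · exact absurd (c3.trans c1) c2
  · simp only [n1, n2, n3, c1, c2, c3]; simp; ring
  · have := conv_V hc c3 c2 n1 c1
    simp only [n1, n2, n3, c1, c2, c3]; simp; linarith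
  · simp only [n1, n2, n3, c1, c2, c3]; simp; ring
  · simp only [n1, n2, n3, c1, c2, c3]; simp; ring
  · simp only [n1, n2, n3, c1, c2, c3]; simp; ring

lemma S6_zero (lam : YoungDiagram) (x y z : ℕ × ℕ) : S6 lam.cells x y z = 0 := by
  by_cases h1 : P lam.cells x y z
  · exact S6_of_P h1
  by_cases h2 : P lam.cells x z y
  · rw [← S6_of_P h2]; unfold S6; ring
  by_cases h3 : P lam.cells y x z
  · rw [← S6_of_P h3]; unfold S6; ring
  by_cases h4 : P lam.cells y z x
  · rw [← S6_of_P h4]; unfold S6; ring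
  by_cases h5 : P lam.cells z x y
  · rw [← S6_of_P h5]; unfold S6; ring
  by_cases h6 : P lam.cells z y x
  · rw [← S6_of_P h6]; unfold S6; ring
  simp [S6, Q, h1, h2, h3, h4, h5, h6]

lemma sum_symm {s : Finset (ℕ × ℕ)} (F : ℕ × ℕ → ℕ × ℕ → ℕ × ℕ → ℚ)
    (h : ∀ x y z, F x y z + F x z y + F y x z + F y z x + F z x y + F z y x = 0) :
    ∑ x ∈ s, ∑ y ∈ s, ∑ z ∈ s, F x y z = 0 := by
  have e : ∑ x ∈ s, ∑ y ∈ s, ∑ z ∈ s,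
    (F x y z + F x z y + F y x z + F y z x + F z x y + F z y x) = 0 := by simp [h]
  simp only [sum_add_distrib] at e
  have e1 : ∑ x ∈ s, ∑ y ∈ s, ∑ z ∈ s, F x z y = ∑ x ∈ s, ∑ y ∈ s, ∑ z ∈ s, F x y z :=
    sum_congr rfl fun x _ => sum_comm
  have e2 : ∑ x ∈ s, ∑ y ∈ s, ∑ z ∈ s, F y x z = ∑ x ∈ s, ∑ y ∈ s, ∑ z ∈ s, F x y z := sum_comm
  have e3 : ∑ x ∈ s, ∑ y ∈ s, ∑ z ∈ s, F y z x = ∑ x ∈ s, ∑ y ∈ s, ∑ z ∈ s, F x y z := by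
    rw [sum_comm]; exact sum_congr rfl fun x _ => sum_comm
  have e4 : ∑ x ∈ s, ∑ y ∈ s, ∑ z ∈ s, F z x y = ∑ x ∈ s, ∑ y ∈ s, ∑ z ∈ s, F x y z := by
    exact (sum_congr rfl fun x _ => sum_comm).trans sum_comm
  have e5 : ∑ x ∈ s, ∑ y ∈ s, ∑ z ∈ s, F z y x = ∑ x ∈ s, ∑ y ∈ s, ∑ z ∈ s, F x y z := by
    rw [← e4]
    exact sum_comm
  linarith

lemma comm3 (g : YoungDiagram → ℚ) :
    M (D (D (D g))) - (3:ℚ) • D (M (D (D g))) + (3:ℚ) • D (D (M (D g))) - D (D (D (M g))) = 0 := by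
  classical
  ext lam
  have := triple g lam
  simp only [Pi.sub_apply, Pi.add_apply, Pi.smul_apply, smul_eq_mul, Pi.zero_apply]
  rw [this]
  apply sum_symm
  intro x y z
  have h := S6_zero lam x y z
  have hs : ∀ a b c, (if P lam.cells a b c then
        (ct a - 2 * ct b + ct c) * ext g (((lam.cells.erase a).erase b).erase c) else 0)
      = Q lam.cells a b c * ext g (lam.cells \ {a, b, c}) := by
    intro a b c
    have : ((lam.cells.erase a).erase b).erase c = lam.cells \ {a, b, c} := by
      ext w; simp; tauto
    rw [this, Q]
    split_ifs <;> simp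
  simp only [hs]
  have p1 : ({x, z, y} : Finset (ℕ × ℕ)) = {x, y, z} := by ext; simp; tauto
  have p2 : ({y, x, z} : Finset (ℕ × ℕ)) = {x, y, z} := by ext; simp; tauto
  have p3 : ({y, z, x} : Finset (ℕ × ℕ)) = {x, y, z} := by ext; simp; tauto
  have p4 : ({z, x, y} : Finset (ℕ × ℕ)) = {x, y, z} := by ext; simp; tauto
  have p5 : ({z, y, x} : Finset (ℕ × ℕ)) = {x, y, z} := by ext; simp; tauto
  rw [p1, p2, p3, p4, p5, ← add_mul, ← add_mul, ← add_mul, ← add_mul, ← add_mul]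
  unfold S6 at h
  rw [h, zero_mul]

/-- Chains of length `n`. -/
def Ch (n : ℕ) (mu : YoungDiagram) : Type :=
  {c : Fin (n + 1) → YoungDiagram //
    c 0 = ⊥ ∧ c (Fin.last n) = mu ∧
    ∀ i : Fin n, c i.castSucc ≤ c i.succ ∧ (c i.succ).card = (c i.castSucc).card + 1}

lemma er_le {lam : YoungDiagram} {x : ℕ × ℕ} (h : Corner lam.cells x) : er lam x ≤ lam := by
  rw [← YoungDiagram.cells_subset_iff, er_cells h]
  exact erase_subset _ _

lemma er_card {lam : YoungDiagram} {x : ℕ × ℕ} (h : Corner lam.cells x) :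
    lam.card = (er lam x).card + 1 := by
  rw [YoungDiagram.card, YoungDiagram.card, er_cells h, card_erase_add_one h.1]

lemma exists_er {lam mu : YoungDiagram} (h : mu ≤ lam) (hc : lam.card = mu.card + 1) :
    ∃ x, Corner lam.cells x ∧ er lam x = mu := by
  rw [← YoungDiagram.cells_subset_iff] at h
  have h1 : (lam.cells \ mu.cells).card = 1 := by
    rw [card_sdiff_of_subset h]
    unfold YoungDiagram.card at hc
    omega
  obtain ⟨x, hx⟩ := card_eq_one.1 h1
  have hx' : ∀ w, (w ∈ lam.cells ∧ w ∉ mu.cells) ↔ w = x := by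
    intro w; rw [← mem_sdiff, hx, mem_singleton]
  have hxl := (hx' x).2 rfl
  have hco : Corner lam.cells x := by
    refine ⟨hxl.1, fun y hy hxy => (hx' y).1 ⟨hy, fun hm => hxl.2 (mu.isLowerSet hxy hm)⟩⟩
  refine ⟨x, hco, ?_⟩
  apply YoungDiagram.ext
  rw [er_cells hco]
  ext w
  rw [mem_erase]
  constructor
  · rintro ⟨hw, hl⟩
    by_contra hm
    exact hw ((hx' w).1 ⟨hl, hm⟩)
  · intro hm
    refine ⟨?_, h hm⟩
    rintro rfl
    exact hxl.2 hm

lemma er_inj {lam : YoungDiagram} {x y : ℕ × ℕ} (hx : Corner lam.cells x)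
    (hy : Corner lam.cells y) (h : er lam x = er lam y) : x = y := by
  have := congrArg YoungDiagram.cells h
  rw [er_cells hx, er_cells hy] at this
  by_contra hne
  have h2 : x ∈ lam.cells.erase y := mem_erase.2 ⟨hne, hx.1⟩
  rw [← this] at h2
  simp at h2

/-- corners -/
abbrev Cor (lam : YoungDiagram) : Type := {x : lam.cells // Corner lam.cells x.1}

noncomputable instance (lam : YoungDiagram) : Fintype (Cor lam) := Fintype.ofFinite _

/-- extend a chain -/
def snocMap (n : ℕ) (lam : YoungDiagram) (p : Σ x : Cor lam, Ch n (er lam x.1.1)) :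
    Ch (n + 1) lam :=
  ⟨Fin.snoc (α := fun _ => YoungDiagram) p.2.1 lam, by
    obtain ⟨⟨x, hx⟩, c, h0, hl, hs⟩ := p
    refine ⟨?_, by simp, ?_⟩
    · have : (0 : Fin (n + 1 + 1)) = (0 : Fin (n+1)).castSucc := rfl
      rw [this, Fin.snoc_castSucc]
      exact h0
    · intro i
      refine Fin.lastCases ?_ (fun i => ?_) i
      · rw [Fin.snoc_castSucc, Fin.succ_last, Fin.snoc_last]
        change c (Fin.last n) ≤ lam ∧ lam.card = (c (Fin.last n)).card + 1
        rw [hl]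
        exact ⟨er_le hx, er_card hx⟩
      · rw [Fin.snoc_castSucc, Fin.succ_castSucc, Fin.snoc_castSucc]
        exact hs i⟩

lemma snocMap_bij (n : ℕ) (lam : YoungDiagram) : Function.Bijective (snocMap n lam) := by
  constructor
  · rintro ⟨⟨⟨x, hx0⟩, hx⟩, c, h0, hl, hs⟩ ⟨⟨⟨y, hy0⟩, hy⟩, d, k0, kl, ks⟩ h
    have h := congrArg Subtype.val h
    simp only [snocMap] at h
    have hcd : c = d := by
      have := congrArg (Fin.init (α := fun _ => YoungDiagram)) h
      simpa using this
    subst hcd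
    have : x = y := er_inj hx hy (hl.symm.trans kl)
    subst this
    rfl
  · rintro ⟨c, h0, hl, hs⟩
    have hlast := hs (Fin.last n)
    rw [Fin.succ_last, hl] at hlast
    obtain ⟨x, hx, he⟩ := exists_er hlast.1 hlast.2
    refine ⟨⟨⟨⟨x, hx.1⟩, hx⟩, ⟨Fin.init c, ?_, ?_, ?_⟩⟩, ?_⟩
    · exact h0
    · exact he.symm
    · intro i
      exact hs i.castSucc
    · apply Subtype.ext
      simp only [snocMap]
      rw [← hl]
      exact Fin.snoc_init_self c

/-- the peeling equivalence -/
noncomputable def peel (n : ℕ) (lam : YoungDiagram) :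
    (Σ x : Cor lam, Ch n (er lam x.1.1)) ≃ Ch (n + 1) lam :=
  Equiv.ofBijective _ (snocMap_bij n lam)

instance finCh0 (lam : YoungDiagram) : Subsingleton (Ch 0 lam) := by
  constructor
  rintro ⟨c, h0, hl, hs⟩ ⟨d, k0, kl, ks⟩
  apply Subtype.ext
  funext i
  have : i = 0 := Fin.ext (by omega)
  subst this
  exact h0.trans k0.symm

instance finCh (n : ℕ) : ∀ lam : YoungDiagram, Finite (Ch n lam) := by
  induction n with
  | zero => intro lam; infer_instance
  | succ n ih =>
    intro lam
    exact Finite.of_equiv _ (peel n lam)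

noncomputable instance (n : ℕ) (lam : YoungDiagram) : Fintype (Ch n lam) := Fintype.ofFinite _

open Classical in
lemma D_apply (g : YoungDiagram → ℚ) (lam : YoungDiagram) :
    D g lam = ∑ x : Cor lam, g (er lam x.1.1) := by
  show ∑ x ∈ lam.cells, _ = _
  rw [← Finset.sum_coe_sort lam.cells, ← Finset.sum_filter]
  exact Finset.sum_subtype _ (by simp) _

lemma sum_peel (n : ℕ) (lam : YoungDiagram) (f : Ch (n + 1) lam → ℚ) :
    ∑ c, f c = ∑ x : Cor lam, ∑ c : Ch n (er lam x.1.1), f (snocMap n lam ⟨x, c⟩) := by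
  rw [← (peel n lam).sum_comp, Fintype.sum_sigma]
  rfl

/-- number of chains -/
noncomputable def N (n : ℕ) : YoungDiagram → ℚ := fun lam => (Fintype.card (Ch n lam) : ℚ)

lemma N_succ (n : ℕ) : N (n + 1) = D (N n) := by
  funext lam
  have := sum_peel n lam (fun _ => 1)
  rw [D_apply]
  simpa [N] using this

/-- The sum of the content sum at level `n - k`. -/
lemma sum_level (j k : ℕ) : ∀ (lam : YoungDiagram),
    ∑ c : Ch (j + k) lam, ((c.1 ⟨j, by omega⟩).contentSum : ℚ) = (D ^ k) (M (N j)) lam := by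
  induction k with
  | zero =>
    intro lam
    have : ∀ c : Ch j lam, c.1 ⟨j, by omega⟩ = lam := fun c => c.2.2.1
    simp [this, M, N, mul_comm]
  | succ k ih =>
    intro lam
    rw [pow_succ', Module.End.mul_apply, D_apply]
    refine (sum_peel (j + k) lam _).trans ?_
    refine sum_congr rfl fun x _ => ?_
    rw [← ih]
    refine sum_congr rfl fun c _ => ?_
    congr 2
    exact Fin.snoc_castSucc (α := fun _ => YoungDiagram) (n := j + k + 1) lam c.1 ⟨j, by omega⟩

lemma rec3 (j k : ℕ) (lam : YoungDiagram) :
    (D ^ k) (M (N (j + 3))) lam - 3 * (D ^ (k + 1)) (M (N (j + 2))) lam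
      + 3 * (D ^ (k + 2)) (M (N (j + 1))) lam - (D ^ (k + 3)) (M (N j)) lam = 0 := by
  have h := congrArg (fun f => (D ^ k) f lam) (comm3 (N j))
  simp only [map_sub, map_add, map_smul, map_zero, Pi.sub_apply, Pi.add_apply, Pi.smul_apply,
    smul_eq_mul, Pi.zero_apply, ← N_succ] at h
  simpa only [pow_add, pow_succ, pow_zero, one_mul, Module.End.mul_apply] using h

lemma card_of_Ch {n : ℕ} {lam : YoungDiagram} (c : Ch n lam) (i : Fin (n + 1)) :
    (c.1 i).card = i := by
  obtain ⟨c, h0, hl, hs⟩ := c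
  refine Fin.induction ?_ (fun i ih => ?_) i
  · simp [h0, YoungDiagram.card]
  · rw [(hs i).2, ih]; simp

lemma content_small {lam : YoungDiagram} (h : lam.card ≤ 1) : lam.contentSum = 0 := by
  unfold YoungDiagram.contentSum
  refine sum_eq_zero fun x hx => ?_
  have h0 : ((0, 0) : ℕ × ℕ) ∈ lam.cells := lam.isLowerSet (Prod.mk_le_mk.2 ⟨Nat.zero_le _, Nat.zero_le _⟩ : ((0, 0) : ℕ × ℕ) ≤ (x.1, x.2)) hx
  have : x = (0, 0) := card_le_one.1 h x hx _ h0
  simp [this]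

lemma M_small {j : ℕ} (hj : j ≤ 1) : M (N j) = 0 := by
  funext lam
  simp only [M, N, Pi.zero_apply, mul_eq_zero]
  by_cases h : lam.card ≤ 1
  · left; rw [content_small h]; simp
  · right
    rw [Nat.cast_eq_zero, Fintype.card_eq_zero_iff]
    refine ⟨fun c => h ?_⟩
    have := card_of_Ch c (Fin.last j)
    rw [c.2.2.1] at this
    simp at this; omega

lemma quad (n : ℕ) (u : ℕ → ℚ) (h0 : u 0 = 0) (h1 : u 1 = 0)
    (h : ∀ j, j + 3 ≤ n → u (j + 3) - 3 * u (j + 2) + 3 * u (j + 1) - u j = 0) :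
    ∀ j ≤ n, u j = j * (j - 1) / 2 * u 2 := by
  intro j
  induction j using Nat.strong_induction_on with
  | _ j ih =>
    intro hj
    match j, ih, hj with
    | 0, _, _ => simp [h0]
    | 1, _, _ => simp [h1]
    | 2, _, _ => norm_num
    | j + 3, ih, hj =>
      have a := ih j (by omega) (by omega)
      have b := ih (j + 1) (by omega) (by omega)
      have c := ih (j + 2) (by omega) (by omega)
      have d := h j hj
      rw [a, b, c] at d
      push_cast at *
      linear_combination d

lemma exists_chain (n : ℕ) : ∀ lam : YoungDiagram, lam.card = n → Nonempty (Ch n lam) := by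
  induction n with
  | zero =>
    intro lam h
    have : lam = ⊥ := by
      apply YoungDiagram.ext
      simpa [YoungDiagram.card] using h
    exact ⟨⟨fun _ => ⊥, rfl, this.symm, fun i => i.elim0⟩⟩
  | succ n ih =>
    intro lam h
    have hne : lam.cells.Nonempty := by
      rw [← card_pos]; unfold YoungDiagram.card at h; omega
    obtain ⟨x, hx⟩ := lam.cells.exists_maximal hne
    have hc : Corner lam.cells x := ⟨hx.1, fun y hy hxy => le_antisymm (hx.2 hy hxy) hxy⟩
    have := er_card hc
    obtain ⟨c⟩ := ih (er lam x) (by omega)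
    exact ⟨snocMap n lam ⟨⟨⟨x, hc.1⟩, hc⟩, c⟩⟩

lemma level (n : ℕ) (lam : YoungDiagram) (j : ℕ) (hj : j ≤ n) :
    ∑ c : Ch n lam, ((c.1 ⟨j, by omega⟩).contentSum : ℚ) = (D ^ (n - j)) (M (N j)) lam := by
  obtain ⟨k, rfl⟩ := Nat.exists_eq_add_of_le hj
  rw [Nat.add_sub_cancel_left]
  exact sum_level j k lam

end SytAux

theorem expected_content_of_jth_box (lam : YoungDiagram) (j : ℕ)
    (hj : 1 ≤ j) (hj' : j ≤ lam.card) :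
    (∑ᶠ T : SytChain lam,
        (((T.1 ⟨j, Nat.lt_succ_of_le hj'⟩).contentSum : ℚ) -
          ((T.1 ⟨j - 1, Nat.lt_succ_of_le (le_trans (Nat.sub_le j 1) hj')⟩).contentSum : ℚ))) /
      (Nat.card (SytChain lam) : ℚ) =
      ((j : ℚ) - 1) / (lam.card.choose 2 : ℚ) * (lam.contentSum : ℚ) := by
  change (∑ᶠ T : SytAux.Ch lam.card lam, _) / (Nat.card (SytAux.Ch lam.card lam) : ℚ) = _
  rw [finsum_eq_sum_of_fintype, Finset.sum_sub_distrib, SytAux.level _ _ _ hj',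
    SytAux.level _ _ (j - 1) (by omega), Nat.card_eq_fintype_card]
  obtain ⟨n, hn⟩ : ∃ n, lam.card = n := ⟨_, rfl⟩
  have hf : (Fintype.card (SytAux.Ch lam.card lam) : ℚ) ≠ 0 := by
    have := SytAux.exists_chain _ lam rfl
    exact_mod_cast Fintype.card_ne_zero
  have q := SytAux.quad lam.card (fun j => (SytAux.D ^ (lam.card - j)) (SytAux.M (SytAux.N j)) lam)
    (by simp [SytAux.M_small]) (by simp [SytAux.M_small]) (by
      intro i hi
      have := SytAux.rec3 i (lam.card - (i + 3)) lam
      rw [show lam.card - (i + 3) + 1 = lam.card - (i + 2) by omega,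
        show lam.card - (i + 3) + 2 = lam.card - (i + 1) by omega,
        show lam.card - (i + 3) + 3 = lam.card - i by omega] at this
      exact this)
  have q1 := q j hj'
  have q2 := q (j - 1) (by omega)
  have q3 := q lam.card le_rfl
  rw [q1, q2]
  set b := (SytAux.D ^ (lam.card - 2)) (SytAux.M (SytAux.N 2)) lam
  simp only [Nat.sub_self, pow_zero, Module.End.one_apply, SytAux.M, SytAux.N] at q3
  rw [Nat.cast_choose_two, Nat.cast_sub hj]
  rcases Nat.lt_or_ge lam.card 2 with h2 | h2
  · have : j = 1 := by omega
    subst this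
    simp
  have h3 : (2 : ℚ) ≤ lam.card := by exact_mod_cast h2
  have h4 : (lam.card : ℚ) ≠ 0 := by linarith
  have h5 : (lam.card : ℚ) - 1 ≠ 0 := by linarith
  field_simp
  push_cast
  linear_combination (-4 * ((j:ℚ) - 1)) * q3
end

section
/- The Jack_α measure is a probability measure: for every n ≥ 1 and α > 0, the sum over partitions λ of n of α^n n!/(c_λ(α) c'_λ(α)) equals 1, where c_λ(α) = Π_{s∈λ}(α·a(s) + l(s) + 1) and c'_λ(α) = Π_{s∈λ}(α·a(s) + l(s) + α). -/
/-- The arm length of the box `x = (i,j)` in `μ`: the number of boxes to its right in row `i`. -/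
def YoungDiagram.arm (μ : YoungDiagram) (x : ℕ × ℕ) : ℕ := μ.rowLen x.1 - x.2 - 1

/-- The leg length of the box `x = (i,j)` in `μ`: the number of boxes below it in column `j`. -/
def YoungDiagram.leg (μ : YoungDiagram) (x : ℕ × ℕ) : ℕ := μ.colLen x.2 - x.1 - 1

/-- `c_μ(α) = Π_{s∈μ} (α·a(s) + l(s) + 1)`. -/
def jackC (α : ℝ) (μ : YoungDiagram) : ℝ :=
  ∏ x ∈ μ.cells, (α * μ.arm x + μ.leg x + 1)

/-- `c'_μ(α) = Π_{s∈μ} (α·a(s) + l(s) + α)`. -/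
def jackC' (α : ℝ) (μ : YoungDiagram) : ℝ :=
  ∏ x ∈ μ.cells, (α * μ.arm x + μ.leg x + α)

open Finset Polynomial in
lemma jk_coeffs (a : ℕ → ℝ) (N : ℕ) :
    ∃ E : ℝ, 2 * E = (∑ i ∈ range N, a i) ^ 2 - ∑ i ∈ range N, (a i) ^ 2 ∧
    (X ^ 2 * ∏ i ∈ range N, (X - C (a i)) : ℝ[X]).coeff N = E ∧
    (X ^ 2 * ∏ i ∈ range N, (X - C (a i)) : ℝ[X]).coeff (N + 1) = - ∑ i ∈ range N, a i ∧
    (X ^ 2 * ∏ i ∈ range N, (X - C (a i)) : ℝ[X]).coeff (N + 2) = 1 ∧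
    ∀ m, N + 2 < m → (X ^ 2 * ∏ i ∈ range N, (X - C (a i)) : ℝ[X]).coeff m = 0 := by
  induction N with
  | zero =>
    refine ⟨0, by simp, ?_⟩
    simp [coeff_X_pow]
    intro m hm; omega
  | succ N ih =>
    obtain ⟨E, hE, h0, h1, h2, h3⟩ := ih
    have key : ∀ m, (X ^ 2 * ∏ i ∈ range (N + 1), (X - C (a i)) : ℝ[X]).coeff (m + 1)
      = (X ^ 2 * ∏ i ∈ range N, (X - C (a i)) : ℝ[X]).coeff m
        - (X ^ 2 * ∏ i ∈ range N, (X - C (a i)) : ℝ[X]).coeff (m + 1) * a N := by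
      intro m
      rw [prod_range_succ, ← mul_assoc, mul_sub, coeff_sub, coeff_mul_X, coeff_mul_C]
    refine ⟨E + (∑ i ∈ range N, a i) * a N, ?_, ?_, ?_, ?_, ?_⟩
    · rw [sum_range_succ, sum_range_succ]; linear_combination hE
    · rw [key, h0, h1]; ring
    · rw [key, h1, h2, sum_range_succ]; ring
    · rw [key, h2, h3 _ (by omega)]; ring
    · intro m hm
      obtain ⟨m, rfl⟩ : ∃ k, m = k + 1 := ⟨m - 1, by omega⟩
      rw [key, h3 _ (by omega), h3 _ (by omega)]; ring

open Finset Polynomial in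
lemma jk_down (η : ℕ → ℝ) (N : ℕ) (hinj : Function.Injective η) :
    ∑ k ∈ range (N + 1), ((η k + (N + 1)) * ∏ i ∈ range (N + 1), (η k - η i - 1)) /
      ∏ j ∈ (range (N + 1)).erase k, (η k - η j) =
      - ((∑ i ∈ range (N + 1), η i) + (N + 1) * (N + 2) / 2) := by
  obtain ⟨E, hE, h0, h1, h2, h3⟩ := jk_coeffs η (N + 1)
  obtain ⟨F, hF, g0, g1, g2, g3⟩ := jk_coeffs (fun i => η i + 1) (N + 1)
  set A : ℝ[X] := ∏ i ∈ range (N + 1), (X - C (η i)) with hA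
  set B : ℝ[X] := ∏ i ∈ range (N + 1), (X - C (η i + 1)) with hB
  set R : ℝ[X] := (X + C ((N : ℝ) + 1)) * B - X * A with hR
  have hc : ∀ m, R.coeff m = (X ^ 2 * B).coeff (m + 1) + (N + 1) * (X ^ 2 * B).coeff (m + 2)
      - (X ^ 2 * A).coeff (m + 1) := by
    intro m
    have : X ^ 2 * R = (X ^ 2 * B) * X + C ((N : ℝ) + 1) * (X ^ 2 * B) - (X ^ 2 * A) * X := by
      rw [hR]; ring
    rw [← coeff_X_pow_mul R 2 m, this, coeff_sub, coeff_add, coeff_mul_X, coeff_C_mul, coeff_mul_X]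
  have hdeg : R.degree < #(range (N + 1)) := by
    rw [card_range, degree_lt_iff_coeff_zero]
    intro m hm
    rw [hc]
    rcases Nat.lt_or_ge (N + 1) m with h | h
    · rcases Nat.lt_or_ge (N + 2) m with h' | h'
      · rw [g3 _ (by omega), g3 _ (by omega), h3 _ (by omega)]; ring
      · obtain rfl : m = N + 2 := by omega
        rw [g2, h2, g3 _ (by omega)]; ring
    · obtain rfl : m = N + 1 := by omega
      rw [g1, g2, h1, sum_add_distrib]; simp; ring
  have := Lagrange.coeff_eq_sum (v := η) hinj.injOn hdeg
  rw [card_range, Nat.add_sub_cancel, hc, g0, g1, h0] at this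
  have e : ∀ k ∈ range (N + 1), R.eval (η k) =
      (η k + (N + 1)) * ∏ i ∈ range (N + 1), (η k - η i - 1) := by
    intro k hk
    have : A.eval (η k) = 0 := by
      rw [hA, eval_prod]; exact prod_eq_zero hk (by simp)
    rw [hR, eval_sub, eval_mul, eval_mul, this, hB, eval_prod]
    simp [sub_sub]
  rw [sum_congr rfl (fun k hk => by rw [← e k hk]), ← this]
  have hs : ∑ i ∈ range (N + 1), (η i + 1) ^ 2 = ∑ i ∈ range (N + 1), (η i) ^ 2 +
      2 * ∑ i ∈ range (N + 1), η i + (N + 1) := by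
    simp only [add_sq, sum_add_distrib, mul_sum]; simp
  have hs' : ∑ i ∈ range (N + 1), (η i + 1) = ∑ i ∈ range (N + 1), η i + (N + 1) := by
    simp [sum_add_distrib]
  rw [hs, hs'] at hF
  rw [hs']
  linear_combination (hF - hE) / 2

open Finset Polynomial in
lemma jk_up (ξ : ℕ → ℝ) (N : ℕ) (hinj : Function.Injective ξ) :
    ∑ k ∈ range (N + 1), (∏ i ∈ range N, (ξ k - ξ i + 1)) /
      ∏ j ∈ (range (N + 1)).erase k, (ξ k - ξ j) = 1 := by
  have hdeg : (Lagrange.nodal (range N) (fun i => ξ i - 1)).degree < #(range (N + 1)) := by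
    rw [Lagrange.degree_nodal]; simp; norm_cast; omega
  have := Lagrange.coeff_eq_sum (v := ξ) hinj.injOn hdeg
  have hm : (Lagrange.nodal (range N) (fun i => ξ i - 1)).coeff N = 1 := by
    have := Lagrange.nodal_monic (s := range N) (v := fun i => ξ i - 1)
    rw [Monic, leadingCoeff, Lagrange.natDegree_nodal, card_range] at this
    exact this
  rw [card_range, Nat.add_sub_cancel, hm] at this
  refine Eq.trans ?_ this.symm
  refine sum_congr rfl fun k _ => ?_
  rw [Lagrange.eval_nodal]
  congr 1
  exact prod_congr rfl fun i _ => by ring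

/-- coordinates -/
def jkXi (α : ℝ) (μ : YoungDiagram) (i : ℕ) : ℝ := α * μ.rowLen i - i

open Finset in
noncomputable def jkUp (α : ℝ) (N : ℕ) (μ : YoungDiagram) (k : ℕ) : ℝ :=
  (∏ i ∈ range N, (jkXi α μ k - jkXi α μ i + 1)) /
      ∏ j ∈ (range (N + 1)).erase k, (jkXi α μ k - jkXi α μ j)

open Finset in
noncomputable def jkDn (α : ℝ) (N : ℕ) (μ : YoungDiagram) (k : ℕ) : ℝ :=
  - (((jkXi α μ k - 1 + N) * ∏ i ∈ range N, (jkXi α μ k - jkXi α μ i - 1)) /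
      ∏ j ∈ (range N).erase k, (jkXi α μ k - jkXi α μ j))

lemma jkXi_lt {α : ℝ} (hα : 0 < α) (μ : YoungDiagram) {i j : ℕ} (h : i < j) :
    jkXi α μ j < jkXi α μ i := by
  unfold jkXi
  have h1 : (μ.rowLen j : ℝ) ≤ μ.rowLen i := by exact_mod_cast μ.rowLen_anti i j h.le
  have h2 : (i : ℝ) < j := by exact_mod_cast h
  nlinarith

lemma jkXi_inj {α : ℝ} (hα : 0 < α) (μ : YoungDiagram) : Function.Injective (jkXi α μ) :=
  (strictAnti_nat_of_succ_lt fun _ => jkXi_lt hα μ (Nat.lt_succ_self _)).injective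

open Finset in
lemma jk_rowLen_zero (μ : YoungDiagram) (i : ℕ) (h : μ.card ≤ i) : μ.rowLen i = 0 := by
  by_contra hne
  have hsub : (range (i + 1)).image (fun r => (r, 0)) ⊆ μ.cells := by
    intro x hx
    simp only [mem_image, mem_range] at hx
    obtain ⟨r, hr, rfl⟩ := hx
    rw [YoungDiagram.mem_cells]
    exact μ.up_left_mem (Nat.lt_succ_iff.mp hr) le_rfl
      (YoungDiagram.mem_iff_lt_rowLen.mpr (Nat.pos_of_ne_zero hne))
  have := card_le_card hsub
  rw [card_image_of_injective _ (fun a b h => by simpa using h), card_range] at this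
  change i + 1 ≤ μ.card at this
  omega

open Finset in
lemma jk_sum_rowLen (μ : YoungDiagram) (N : ℕ) (h : μ.card ≤ N) :
    ∑ i ∈ range N, μ.rowLen i = μ.card := by
  change _ = #μ.cells
  rw [card_eq_sum_card_fiberwise (f := Prod.fst) (t := range N)]
  · exact sum_congr rfl fun i _ => μ.rowLen_eq_card
  · intro x hx
    have hx' : (x.1, x.2) ∈ μ := by simpa using hx
    rw [YoungDiagram.mem_iff_lt_rowLen] at hx'
    simp only [coe_range, Set.mem_Iio]
    by_contra hc
    rw [jk_rowLen_zero μ x.1 (by omega)] at hx'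
    omega

open Finset in
lemma jk_sum_up {α : ℝ} (hα : 0 < α) (μ : YoungDiagram) (n : ℕ) (hn : μ.card = n) :
    ∑ k ∈ range (n + 1), jkUp α (n + 1) μ k = 1 := by
  have := jk_up (jkXi α μ) (n + 1) (jkXi_inj hα μ)
  rw [sum_range_succ] at this
  rw [← this, eq_comm]
  simp only [jkUp]
  apply add_eq_left.mpr
  rw [div_eq_zero_iff]; left
  apply prod_eq_zero (i := n) (by simp)
  simp [jkXi, jk_rowLen_zero μ n (by omega), jk_rowLen_zero μ (n + 1) (by omega)]

open Finset in
lemma jk_sum_dn {α : ℝ} (hα : 0 < α) (μ : YoungDiagram) (n : ℕ) (hn : μ.card = n + 1) :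
    ∑ k ∈ range (n + 1), jkDn α (n + 1) μ k = α * (n + 1) := by
  have := jk_down (fun i => jkXi α μ i - 1) n (fun a b h => jkXi_inj hα μ (by simpa using h))
  simp only [sub_sub_sub_cancel_right] at this
  simp only [jkDn, sum_neg_distrib]
  push_cast
  rw [this, neg_neg]
  have h1 := jk_sum_rowLen μ (n + 1) (by omega)
  have h2 : ∑ i ∈ range (n + 1), (μ.rowLen i : ℝ) = n + 1 := by
    rw [hn] at h1; exact_mod_cast h1
  have h3 : ∀ m : ℕ, ∑ i ∈ range (m + 1), (i : ℝ) = m * (m + 1) / 2 := by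
    intro m
    induction m with
    | zero => simp
    | succ m ih => rw [sum_range_succ, ih]; push_cast; ring
  simp only [jkXi, sum_sub_distrib, ← mul_sum, h2, h3]
  simp
  ring

/-- row `k` is addable -/
def jkAddable (μ : YoungDiagram) (k : ℕ) : Prop := ∀ i < k, μ.rowLen k < μ.rowLen i

/-- row `k` is removable -/
def jkRemovable (μ : YoungDiagram) (k : ℕ) : Prop := μ.rowLen (k + 1) < μ.rowLen k

lemma jk_ext {μ ν : YoungDiagram} (h : ∀ i, μ.rowLen i = ν.rowLen i) : μ = ν := by
  ext ⟨i, j⟩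
  rw [YoungDiagram.mem_cells, YoungDiagram.mem_cells, YoungDiagram.mem_iff_lt_rowLen,
    YoungDiagram.mem_iff_lt_rowLen, h]

lemma jk_rowLen_eq {μ : YoungDiagram} {i m : ℕ} (h : ∀ j, (i, j) ∈ μ ↔ j < m) :
    μ.rowLen i = m := by
  have h' : ∀ j, j < μ.rowLen i ↔ j < m := fun j => by
    rw [← YoungDiagram.mem_iff_lt_rowLen, h]
  exact le_antisymm (le_of_not_gt fun hc => by have := (h' m).1 hc; omega)
    (le_of_not_gt fun hc => by have := (h' (μ.rowLen i)).2 hc; omega)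

lemma jk_colLen_eq {μ : YoungDiagram} {j m : ℕ} (h : ∀ i, (i, j) ∈ μ ↔ i < m) :
    μ.colLen j = m := by
  have h' : ∀ i, i < μ.colLen j ↔ i < m := fun i => by
    rw [← YoungDiagram.mem_iff_lt_colLen, h]
  exact le_antisymm (le_of_not_gt fun hc => by have := (h' m).1 hc; omega)
    (le_of_not_gt fun hc => by have := (h' (μ.colLen j)).2 hc; omega)

lemma jk_add_lower (μ : YoungDiagram) (k : ℕ) (h : jkAddable μ k) :
    IsLowerSet (↑(insert (k, μ.rowLen k) μ.cells) : Set (ℕ × ℕ)) := by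
  rintro ⟨a, b⟩ ⟨c, d⟩ hle hmem
  obtain ⟨h1, h2⟩ := Prod.mk_le_mk.mp hle
  simp only [Finset.coe_insert, Set.mem_insert_iff, Prod.mk.injEq, Finset.mem_coe,
    YoungDiagram.mem_cells, YoungDiagram.mem_iff_lt_rowLen] at hmem ⊢
  rcases hmem with ⟨rfl, rfl⟩ | hmem
  · rcases Nat.lt_or_ge c a with hc | hc
    · right; have := h c hc; omega
    · obtain rfl : c = a := by omega
      omega
  · right
    have := μ.rowLen_anti c a h1
    omega

lemma jk_rem_lower (μ : YoungDiagram) (k : ℕ) (h : jkRemovable μ k) :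
    IsLowerSet (↑(μ.cells.erase (k, μ.rowLen k - 1)) : Set (ℕ × ℕ)) := by
  rintro ⟨a, b⟩ ⟨c, d⟩ hle hmem
  obtain ⟨h1, h2⟩ := Prod.mk_le_mk.mp hle
  simp only [Finset.coe_erase, Set.mem_sdiff, Set.mem_singleton_iff, Prod.mk.injEq, Finset.mem_coe,
    YoungDiagram.mem_cells, YoungDiagram.mem_iff_lt_rowLen] at hmem ⊢
  obtain ⟨hm, hne⟩ := hmem
  have := μ.rowLen_anti c a h1
  refine ⟨by omega, ?_⟩
  rintro ⟨rfl, rfl⟩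
  unfold jkRemovable at h
  rcases Nat.lt_or_ge c a with hc | hc
  · have := μ.rowLen_anti (c + 1) a hc
    omega
  · obtain rfl : a = c := by omega
    omega

open Classical in
noncomputable def jkAdd (μ : YoungDiagram) (k : ℕ) : YoungDiagram :=
  if h : jkAddable μ k then ⟨insert (k, μ.rowLen k) μ.cells, jk_add_lower μ k h⟩ else μ

open Classical in
noncomputable def jkRem (μ : YoungDiagram) (k : ℕ) : YoungDiagram :=
  if h : jkRemovable μ k then ⟨μ.cells.erase (k, μ.rowLen k - 1), jk_rem_lower μ k h⟩ else μ

lemma jkAdd_cells {μ : YoungDiagram} {k : ℕ} (h : jkAddable μ k) :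
    (jkAdd μ k).cells = insert (k, μ.rowLen k) μ.cells := by
  simp [jkAdd, h]

lemma jkRem_cells {μ : YoungDiagram} {k : ℕ} (h : jkRemovable μ k) :
    (jkRem μ k).cells = μ.cells.erase (k, μ.rowLen k - 1) := by
  simp [jkRem, h]

lemma jk_new_notMem (μ : YoungDiagram) (k : ℕ) : (k, μ.rowLen k) ∉ μ.cells := by
  rw [YoungDiagram.mem_cells, YoungDiagram.mem_iff_lt_rowLen]; omega

lemma jkAdd_card {μ : YoungDiagram} {k : ℕ} (h : jkAddable μ k) :
    (jkAdd μ k).card = μ.card + 1 := by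
  change (jkAdd μ k).cells.card = μ.cells.card + 1
  rw [jkAdd_cells h, Finset.card_insert_of_notMem (jk_new_notMem μ k)]

lemma jkRem_card {μ : YoungDiagram} {k : ℕ} (h : jkRemovable μ k) :
    (jkRem μ k).card + 1 = μ.card := by
  change (jkRem μ k).cells.card + 1 = μ.cells.card
  rw [jkRem_cells h, Finset.card_erase_add_one]
  rw [YoungDiagram.mem_cells, YoungDiagram.mem_iff_lt_rowLen]
  unfold jkRemovable at h; omega

lemma jkAdd_mem {μ : YoungDiagram} {k : ℕ} (h : jkAddable μ k) (x : ℕ × ℕ) :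
    x ∈ jkAdd μ k ↔ x = (k, μ.rowLen k) ∨ x ∈ μ := by
  rw [← YoungDiagram.mem_cells, jkAdd_cells h, Finset.mem_insert, YoungDiagram.mem_cells]

lemma jkAdd_rowLen {μ : YoungDiagram} {k : ℕ} (h : jkAddable μ k) (i : ℕ) :
    (jkAdd μ k).rowLen i = μ.rowLen i + if i = k then 1 else 0 := by
  apply jk_rowLen_eq
  intro j
  rw [jkAdd_mem h, YoungDiagram.mem_iff_lt_rowLen, Prod.mk.injEq]
  split_ifs with hi
  · subst hi; omega
  · omega

lemma jk_colLen_new {μ : YoungDiagram} {k : ℕ} (h : jkAddable μ k) :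
    μ.colLen (μ.rowLen k) = k := by
  apply jk_colLen_eq
  intro i
  rw [YoungDiagram.mem_iff_lt_rowLen]
  refine ⟨fun hi => ?_, h i⟩
  by_contra hc
  have := μ.rowLen_anti k i (by omega)
  omega

lemma jkAdd_colLen {μ : YoungDiagram} {k : ℕ} (h : jkAddable μ k) (j : ℕ) :
    (jkAdd μ k).colLen j = μ.colLen j + if j = μ.rowLen k then 1 else 0 := by
  apply jk_colLen_eq
  intro i
  rw [jkAdd_mem h, YoungDiagram.mem_iff_lt_colLen, Prod.mk.injEq]
  split_ifs with hi
  · subst hi; have := jk_colLen_new h; omega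
  · omega

lemma jkRem_rowLen {μ : YoungDiagram} {k : ℕ} (h : jkRemovable μ k) (i : ℕ) :
    (jkRem μ k).rowLen i = μ.rowLen i - if i = k then 1 else 0 := by
  apply jk_rowLen_eq
  intro j
  rw [← YoungDiagram.mem_cells, jkRem_cells h, Finset.mem_erase, YoungDiagram.mem_cells,
    YoungDiagram.mem_iff_lt_rowLen, Ne, Prod.mk.injEq]
  split_ifs with hi
  · subst hi; omega
  · omega

lemma jkAdd_removable {μ : YoungDiagram} {k : ℕ} (h : jkAddable μ k) :
    jkRemovable (jkAdd μ k) k := by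
  unfold jkRemovable
  rw [jkAdd_rowLen h, jkAdd_rowLen h]
  have := μ.rowLen_anti k (k + 1) (by omega)
  simp; omega

lemma jkRem_addable {μ : YoungDiagram} {k : ℕ} (h : jkRemovable μ k) :
    jkAddable (jkRem μ k) k := by
  intro i hi
  rw [jkRem_rowLen h, jkRem_rowLen h]
  have := μ.rowLen_anti i k (by omega)
  unfold jkRemovable at h
  rw [if_pos rfl, if_neg (by omega)]; omega

lemma jkRem_add {μ : YoungDiagram} {k : ℕ} (h : jkAddable μ k) : jkRem (jkAdd μ k) k = μ := by
  apply jk_ext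
  intro i
  rw [jkRem_rowLen (jkAdd_removable h), jkAdd_rowLen h]
  omega

lemma jkAdd_rem {μ : YoungDiagram} {k : ℕ} (h : jkRemovable μ k) : jkAdd (jkRem μ k) k = μ := by
  apply jk_ext
  intro i
  rw [jkAdd_rowLen (jkRem_addable h), jkRem_rowLen h]
  unfold jkRemovable at h
  split_ifs with hi
  · subst hi; omega
  · omega

open Finset in
lemma jkUp_zero (α : ℝ) (N : ℕ) (μ : YoungDiagram) (k : ℕ) (hk : k ≤ N)
    (h : ¬ jkAddable μ k) : jkUp α N μ k = 0 := by
  unfold jkAddable at h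
  push Not at h
  obtain ⟨i, hi, hle⟩ := h
  obtain ⟨k, rfl⟩ : ∃ m, k = m + 1 := ⟨k - 1, by omega⟩
  have h1 := μ.rowLen_anti i k (by omega)
  have h2 := μ.rowLen_anti k (k + 1) (by omega)
  have h3 : μ.rowLen (k + 1) = μ.rowLen k := by omega
  unfold jkUp
  rw [div_eq_zero_iff]; left
  apply prod_eq_zero (i := k) (by simp; omega)
  simp [jkXi, h3]

open Finset in
lemma jkDn_zero (α : ℝ) (N : ℕ) (μ : YoungDiagram) (k : ℕ) (hk : k < N) (hN : μ.rowLen N = 0)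
    (h : ¬ jkRemovable μ k) : jkDn α N μ k = 0 := by
  unfold jkRemovable at h
  have h2 := μ.rowLen_anti k (k + 1) (by omega)
  have h3 : μ.rowLen (k + 1) = μ.rowLen k := by omega
  unfold jkDn
  rw [neg_eq_zero, div_eq_zero_iff]; left
  rcases Nat.lt_or_ge (k + 1) N with hc | hc
  · rw [mul_eq_zero]; right
    apply prod_eq_zero (i := k + 1) (by simp; omega)
    simp [jkXi, h3]
  · obtain rfl : N = k + 1 := by omega
    rw [mul_eq_zero]; left
    simp [jkXi, ← h3, hN]

noncomputable def jkH (α β : ℝ) (μ : YoungDiagram) : ℝ :=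
  ∏ x ∈ μ.cells, (α * μ.arm x + μ.leg x + β)

lemma jkH_pos {α β : ℝ} (hα : 0 < α) (hβ : 0 < β) (μ : YoungDiagram) : 0 < jkH α β μ :=
  Finset.prod_pos fun _ _ => by positivity

open Finset in
/-- telescoping along row `k` -/
lemma jk_row_prod {α β : ℝ} (hα : 0 < α) (hβ : 0 < β) (μ : YoungDiagram) (k N : ℕ) (hk : k ≤ N) :
    ∏ j ∈ Ico (μ.rowLen N) (μ.rowLen k),
      ((α * ((μ.arm (k, j) : ℝ) + 1) + μ.leg (k, j) + β) /
        (α * μ.arm (k, j) + μ.leg (k, j) + β)) =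
    ∏ i ∈ Ico k N, ((jkXi α μ k - jkXi α μ (i + 1) - 1 + β) / (jkXi α μ k - jkXi α μ i + β)) := by
  induction N, hk using Nat.le_induction with
  | base => simp
  | succ N hN ih =>
    have e1 := μ.rowLen_anti N (N + 1) (by omega)
    have e2 := μ.rowLen_anti k N hN
    rw [← prod_Ico_consecutive _ e1 e2, ih, prod_Ico_succ_top hN, mul_comm]
    congr 1
    have hcol : ∀ j ∈ Ico (μ.rowLen (N + 1)) (μ.rowLen N), μ.colLen j = N + 1 := by
      intro j hj
      rw [mem_Ico] at hj
      apply jk_colLen_eq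
      intro i
      rw [YoungDiagram.mem_iff_lt_rowLen]
      constructor
      · intro hi
        by_contra hc
        have := μ.rowLen_anti (N + 1) i (by omega)
        omega
      · intro hi
        have := μ.rowLen_anti i N (by omega)
        omega
    -- general telescoping
    have tel : ∀ b, μ.rowLen (N + 1) ≤ b → b ≤ μ.rowLen N →
      ∏ j ∈ Ico (μ.rowLen (N + 1)) b,
        ((α * ((μ.arm (k, j) : ℝ) + 1) + μ.leg (k, j) + β) /
          (α * μ.arm (k, j) + μ.leg (k, j) + β)) =
      (jkXi α μ k - jkXi α μ (N + 1) - 1 + β) /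
        (α * ((μ.rowLen k : ℝ) - b) + (N - k) + β) := by
      intro b hb
      induction b, hb using Nat.le_induction with
      | base =>
        intro _
        rw [Ico_self, prod_empty, eq_comm]
        have : α * ((μ.rowLen k : ℝ) - μ.rowLen (N + 1)) + (N - k) + β
          = jkXi α μ k - jkXi α μ (N + 1) - 1 + β := by
          unfold jkXi; push_cast; ring
        rw [this]
        apply div_self
        rw [← this]
        have h1 : (μ.rowLen (N + 1) : ℝ) ≤ μ.rowLen k := by exact_mod_cast e1.trans e2
        have h2 : (k : ℝ) ≤ N := by exact_mod_cast hN
        have := mul_nonneg hα.le (sub_nonneg.mpr h1)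
        linarith
      | succ b hb ihb =>
        intro hb'
        rw [prod_Ico_succ_top hb, ihb (by omega)]
        have hl : (μ.leg (k, b) : ℝ) = N - k := by
          have : μ.leg (k, b) + k = N := by
            unfold YoungDiagram.leg
            rw [hcol b (by rw [mem_Ico]; omega)]
            simp only
            omega
          rw [← this]; push_cast; ring
        have ha : (μ.arm (k, b) : ℝ) = μ.rowLen k - b - 1 := by
          have : μ.arm (k, b) + b + 1 = μ.rowLen k := by
            unfold YoungDiagram.arm
            simp only
            omega
          rw [← this]; push_cast; ring
        rw [hl, ha]
        have h1 : (b : ℝ) + 1 ≤ μ.rowLen k := by exact_mod_cast hb'.trans e2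
        have h2 : (k : ℝ) ≤ N := by exact_mod_cast hN
        have p1 : α * ((μ.rowLen k : ℝ) - b) + (N - k) + β ≠ 0 := by
          have := mul_nonneg hα.le (show (0 : ℝ) ≤ (μ.rowLen k : ℝ) - b by linarith)
          linarith
        have p2 : α * ((μ.rowLen k : ℝ) - b - 1) + (N - k) + β ≠ 0 := by
          have := mul_nonneg hα.le (show (0 : ℝ) ≤ (μ.rowLen k : ℝ) - b - 1 by linarith)
          linarith
        rw [sub_add_cancel, div_mul_div_cancel₀ p1]
        push_cast
        rw [sub_sub (μ.rowLen k : ℝ)]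
    rw [tel _ e1 le_rfl]
    congr 2
    unfold jkXi; ring

open Finset in
lemma jkH_add {α β : ℝ} (hα : 0 < α) (hβ : 0 < β) (μ : YoungDiagram) (k N : ℕ) (hk : k < N)
    (hN : μ.rowLen N = 0) (h : jkAddable μ k) :
    jkH α β (jkAdd μ k) = jkH α β μ * (jkXi α μ k - jkXi α μ N - 1 + β) *
      (∏ i ∈ range k, (-(jkXi α μ k - jkXi α μ i) - α + β) /
        (-(jkXi α μ k - jkXi α μ i) - α - 1 + β)) *
      ∏ i ∈ Ico (k + 1) N, (jkXi α μ k - jkXi α μ i - 1 + β) / (jkXi α μ k - jkXi α μ i + β) := by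
  have hrow := jk_row_prod hα hβ μ k N hk.le
  have hprod : ∏ i ∈ Ico k N, ((jkXi α μ k - jkXi α μ (i + 1) - 1 + β) /
      (jkXi α μ k - jkXi α μ i + β)) = (jkXi α μ k - jkXi α μ N - 1 + β) / β *
      ∏ i ∈ Ico (k + 1) N, (jkXi α μ k - jkXi α μ i - 1 + β) / (jkXi α μ k - jkXi α μ i + β) := by
    rw [prod_div_distrib, prod_div_distrib, prod_Ico_add' (fun i => jkXi α μ k - jkXi α μ i - 1 + β),
      prod_Ico_succ_top (by omega), prod_eq_prod_Ico_succ_bot hk (fun i => jkXi α μ k - jkXi α μ i + β),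
      sub_self, zero_add]
    rw [mul_comm (∏ i ∈ Ico (k + 1) N, (jkXi α μ k - jkXi α μ i - 1 + β)), mul_div_mul_comm]
  rw [hprod, hN] at hrow
  set L := jkAdd μ k with hL
  have harm : ∀ x ∈ μ.cells, (L.arm x : ℝ) = μ.arm x + if x.1 = k then 1 else 0 := by
    intro x hx
    have hx' : x.2 < μ.rowLen x.1 := by
      rw [← YoungDiagram.mem_iff_lt_rowLen]; simpa using hx
    have : L.arm x = μ.arm x + if x.1 = k then 1 else 0 := by
      unfold YoungDiagram.arm
      rw [hL, jkAdd_rowLen h]; split_ifs <;> omega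
    rw [this]; push_cast; rfl
  have hleg : ∀ x ∈ μ.cells, (L.leg x : ℝ) = μ.leg x + if x.2 = μ.rowLen k then 1 else 0 := by
    intro x hx
    have hx' : x.1 < μ.colLen x.2 := by
      rw [← YoungDiagram.mem_iff_lt_colLen]; simpa using hx
    have : L.leg x = μ.leg x + if x.2 = μ.rowLen k then 1 else 0 := by
      unfold YoungDiagram.leg
      rw [hL, jkAdd_colLen h]; split_ifs <;> omega
    rw [this]; push_cast; rfl
  have hnew : α * (L.arm (k, μ.rowLen k) : ℝ) + L.leg (k, μ.rowLen k) + β = β := by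
    have h1 : L.arm (k, μ.rowLen k) = 0 := by
      unfold YoungDiagram.arm
      rw [hL, jkAdd_rowLen h]; simp
    have h2 : L.leg (k, μ.rowLen k) = 0 := by
      unfold YoungDiagram.leg
      rw [hL, jkAdd_colLen h]; simp [jk_colLen_new h]
    rw [h1, h2]; simp
  have hpos : ∀ x, α * (μ.arm x : ℝ) + μ.leg x + β ≠ 0 := fun x => by positivity
  have hsplit : jkH α β L = β * (jkH α β μ * ((∏ x ∈ μ.row k,
      (α * ((μ.arm x : ℝ) + 1) + μ.leg x + β) / (α * μ.arm x + μ.leg x + β)) *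
      (∏ x ∈ μ.col (μ.rowLen k),
      (α * (μ.arm x : ℝ) + (μ.leg x + 1) + β) / (α * μ.arm x + μ.leg x + β)))) := by
    unfold jkH
    rw [show L.cells = _ from jkAdd_cells h, prod_insert (jk_new_notMem μ k), hnew]
    congr 1
    unfold YoungDiagram.row YoungDiagram.col
    rw [prod_filter, prod_filter, ← prod_mul_distrib, ← prod_mul_distrib]
    refine prod_congr rfl fun x hx => ?_
    rw [harm x hx, hleg x hx]
    have := hpos x
    by_cases h1 : x.1 = k
    · have h2 : x.2 ≠ μ.rowLen k := by
        intro h2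
        apply jk_new_notMem μ k
        rw [← h2, ← h1]; exact hx
      simp only [h1, h2, if_true, if_false]
      field_simp
      try ring
    · by_cases h2 : x.2 = μ.rowLen k
      · simp only [h1, h2, if_true, if_false]
        field_simp
        try ring
      · simp only [h1, h2, if_false]
        ring
  have hcol : (∏ x ∈ μ.col (μ.rowLen k),
      (α * (μ.arm x : ℝ) + (μ.leg x + 1) + β) / (α * μ.arm x + μ.leg x + β)) =
      (∏ i ∈ range k, (-(jkXi α μ k - jkXi α μ i) - α + β) /
        (-(jkXi α μ k - jkXi α μ i) - α - 1 + β)) := by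
    rw [YoungDiagram.col_eq_prod, jk_colLen_new h, prod_product]
    simp only [prod_singleton]
    refine prod_congr rfl fun i hi => ?_
    rw [mem_range] at hi
    have hlt := h i hi
    have ha : (μ.arm (i, μ.rowLen k) : ℝ) = μ.rowLen i - μ.rowLen k - 1 := by
      have : μ.arm (i, μ.rowLen k) + μ.rowLen k + 1 = μ.rowLen i := by
        unfold YoungDiagram.arm
        simp only
        omega
      rw [← this]; push_cast; ring
    have hl : (μ.leg (i, μ.rowLen k) : ℝ) = k - i - 1 := by
      have : μ.leg (i, μ.rowLen k) + i + 1 = k := by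
        unfold YoungDiagram.leg
        simp only [jk_colLen_new h]
        omega
      have h' : (k : ℝ) = μ.leg (i, μ.rowLen k) + i + 1 := by exact_mod_cast this.symm
      rw [h']; ring
    rw [ha, hl]
    unfold jkXi
    congr 1 <;> ring
  rw [hsplit, hcol, YoungDiagram.row_eq_prod, prod_product, prod_singleton, range_eq_Ico, hrow]
  field_simp

open Finset in
lemma jk_prod_split (f : ℕ → ℝ) (k N : ℕ) (hk : k < N) :
    ∏ i ∈ range N, f i = (∏ i ∈ range k, f i) * f k * ∏ i ∈ Ico (k + 1) N, f i := by
  rw [← prod_range_succ, prod_range_mul_prod_Ico _ hk]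

open Finset in
lemma jk_prod_erase (f : ℕ → ℝ) (k N : ℕ) (hk : k < N) :
    ∏ i ∈ (range N).erase k, f i = (∏ i ∈ range k, f i) * ∏ i ∈ Ico (k + 1) N, f i := by
  have : (range N).erase k = range k ∪ Ico (k + 1) N := by
    ext i; simp only [mem_erase, mem_range, mem_union, mem_Ico]; omega
  rw [this, prod_union]
  rw [disjoint_left]
  intro i; simp only [mem_range, mem_Ico]; omega

open Finset in
lemma jk_key {α : ℝ} (hα : 0 < α) (μ : YoungDiagram) (k N : ℕ) (hk : k < N)
    (hN : μ.rowLen N = 0) (h : jkAddable μ k) :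
    jkH α 1 (jkAdd μ k) * jkH α α (jkAdd μ k) * jkUp α N μ k =
      jkH α 1 μ * jkH α α μ * jkDn α N (jkAdd μ k) k := by
  rw [jkH_add hα one_pos μ k N hk hN h, jkH_add hα hα μ k N hk hN h]
  have xk : jkXi α (jkAdd μ k) k = jkXi α μ k + α := by
    unfold jkXi; rw [jkAdd_rowLen h]; simp; ring
  have xi : ∀ i, i ≠ k → jkXi α (jkAdd μ k) i = jkXi α μ i := by
    intro i hi
    unfold jkXi; rw [jkAdd_rowLen h]; simp [hi]
  have xN : jkXi α μ N = -N := by simp [jkXi, hN]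
  set d : ℕ → ℝ := fun i => jkXi α μ k - jkXi α μ i with hd
  have dN : 0 < d N := sub_pos.mpr (jkXi_lt hα μ hk)
  have hup : jkUp α N μ k = (∏ i ∈ range k, (d i + 1) / d i) *
      (∏ i ∈ Ico (k + 1) N, (d i + 1) / d i) / d N := by
    unfold jkUp
    rw [jk_prod_split _ k N hk, jk_prod_erase _ k (N + 1) (by omega), prod_Ico_succ_top (by omega)]
    rw [prod_div_distrib, prod_div_distrib]
    simp only [hd, sub_self, zero_add, mul_one]
    rw [div_mul_div_comm, div_div, mul_assoc]
  have hdn : jkDn α N (jkAdd μ k) k = (d N + α - 1) *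
      (∏ i ∈ range k, (d i + α - 1) / (d i + α)) *
      (∏ i ∈ Ico (k + 1) N, (d i + α - 1) / (d i + α)) := by
    unfold jkDn
    rw [jk_prod_split _ k N hk, jk_prod_erase _ k N (by omega)]
    have a1 : ∀ i ∈ range k, jkXi α (jkAdd μ k) k - jkXi α (jkAdd μ k) i = d i + α := by
      intro i hi
      rw [xk, xi i (by rw [mem_range] at hi; omega)]; simp only [hd]; ring
    have a2 : ∀ i ∈ Ico (k + 1) N, jkXi α (jkAdd μ k) k - jkXi α (jkAdd μ k) i = d i + α := by
      intro i hi
      rw [xk, xi i (by rw [mem_Ico] at hi; omega)]; simp only [hd]; ring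
    rw [prod_congr rfl a1, prod_congr rfl a2,
      prod_congr rfl (fun i hi => by rw [a1 i hi] : ∀ i ∈ range k, _ = d i + α - 1),
      prod_congr rfl (fun i hi => by rw [a2 i hi] : ∀ i ∈ Ico (k + 1) N, _ = d i + α - 1),
      sub_self, zero_sub, prod_div_distrib, prod_div_distrib, xk]
    have : jkXi α μ k + α - 1 + N = d N + α - 1 := by simp only [hd, xN]; ring
    rw [this]
    ring
  rw [hup, hdn]
  change jkH α 1 μ * (d N - 1 + 1) *
      (∏ i ∈ range k, (-(d i) - α + 1) / (-(d i) - α - 1 + 1)) *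
      (∏ i ∈ Ico (k + 1) N, (d i - 1 + 1) / (d i + 1)) *
      (jkH α α μ * (d N - 1 + α) *
      (∏ i ∈ range k, (-(d i) - α + α) / (-(d i) - α - 1 + α)) *
      (∏ i ∈ Ico (k + 1) N, (d i - 1 + α) / (d i + α))) * _ = _
  have p1 : (∏ i ∈ range k, (-(d i) - α + 1) / (-(d i) - α - 1 + 1)) *
      (∏ i ∈ range k, (-(d i) - α + α) / (-(d i) - α - 1 + α)) *
      (∏ i ∈ range k, (d i + 1) / d i) = ∏ i ∈ range k, (d i + α - 1) / (d i + α) := by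
    rw [← prod_mul_distrib, ← prod_mul_distrib]
    refine prod_congr rfl fun i hi => ?_
    rw [mem_range] at hi
    have hlt : (μ.rowLen k : ℝ) + 1 ≤ μ.rowLen i := by exact_mod_cast h i hi
    have hik : (i : ℝ) + 1 ≤ k := by exact_mod_cast hi
    have hde : d i + α ≤ -1 := by
      simp only [hd, jkXi]
      nlinarith
    have n1 : d i + α ≠ 0 := by linarith
    have n2 : d i ≠ 0 := by linarith
    have n3 : d i + 1 ≠ 0 := by linarith
    have r1 : (-(d i) - α + 1) / (-(d i) - α - 1 + 1) = (d i + α - 1) / (d i + α) := by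
      rw [← neg_div_neg_eq]; congr 1 <;> ring
    have r2 : (-(d i) - α + α) / (-(d i) - α - 1 + α) = d i / (d i + 1) := by
      rw [← neg_div_neg_eq]; congr 1 <;> ring
    rw [r1, r2]
    field_simp
  have p2 : (∏ i ∈ Ico (k + 1) N, (d i - 1 + 1) / (d i + 1)) *
      (∏ i ∈ Ico (k + 1) N, (d i - 1 + α) / (d i + α)) *
      (∏ i ∈ Ico (k + 1) N, (d i + 1) / d i) =
      ∏ i ∈ Ico (k + 1) N, (d i + α - 1) / (d i + α) := by
    rw [← prod_mul_distrib, ← prod_mul_distrib]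
    refine prod_congr rfl fun i hi => ?_
    rw [mem_Ico] at hi
    have hdi : 0 < d i := sub_pos.mpr (jkXi_lt hα μ (by omega))
    have n3 : d i + 1 ≠ 0 := by linarith
    have n1 : d i + α ≠ 0 := by linarith
    have n2 := hdi.ne'
    rw [sub_add_cancel, show d i - 1 + α = d i + α - 1 by ring]
    field_simp
  rw [← p1, ← p2]
  field_simp
  ring

lemma jk_finite (n : ℕ) : {μ : YoungDiagram | μ.card = n}.Finite := by
  have hinj : Function.Injective YoungDiagram.cells := fun a b h => YoungDiagram.ext h
  apply Set.Finite.of_finite_image (f := YoungDiagram.cells) _ hinj.injOn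
  apply ((Finset.range n ×ˢ Finset.range n).powerset.finite_toSet).subset
  rintro _ ⟨μ, hμ, rfl⟩
  change μ.card = n at hμ
  simp only [Finset.mem_coe, Finset.mem_powerset]
  intro x hx
  have hx' : (x.1, x.2) ∈ μ := by simpa using hx
  rw [YoungDiagram.mem_iff_lt_rowLen] at hx'
  have h1 : x.1 < n := by
    by_contra hc
    rw [jk_rowLen_zero μ x.1 (by omega)] at hx'; omega
  have h2 : μ.rowLen x.1 ≤ n := by
    rw [YoungDiagram.rowLen_eq_card, ← hμ]
    exact Finset.card_le_card (Finset.filter_subset _ _)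
  rw [Finset.mem_product, Finset.mem_range, Finset.mem_range]
  omega

noncomputable def jkA (n : ℕ) : Finset YoungDiagram := (jk_finite n).toFinset

lemma jk_memA {n : ℕ} {μ : YoungDiagram} : μ ∈ jkA n ↔ μ.card = n := by simp [jkA]

noncomputable def jkW (α : ℝ) (n : ℕ) (μ : YoungDiagram) : ℝ :=
  α ^ n * (n.factorial : ℝ) / (jkH α 1 μ * jkH α α μ)

open Finset Classical in
lemma jk_step {α : ℝ} (hα : 0 < α) (n : ℕ) :
    ∑ μ ∈ jkA (n + 1), jkW α (n + 1) μ = ∑ μ ∈ jkA n, jkW α n μ := by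
  have e1 : ∑ μ ∈ jkA (n + 1), jkW α (n + 1) μ =
      ∑ p ∈ (jkA (n + 1) ×ˢ range (n + 1)).filter (fun p => jkRemovable p.1 p.2),
        jkW α (n + 1) p.1 * (jkDn α (n + 1) p.1 p.2 / (α * (n + 1))) := by
    rw [sum_filter_of_ne, sum_product]
    · refine sum_congr rfl fun μ hμ => ?_
      dsimp only
      rw [← mul_sum, ← sum_div, jk_sum_dn hα μ n (jk_memA.mp hμ), div_self (by positivity), mul_one]
    · rintro ⟨μ, k⟩ hp hne
      simp only [mem_product, mem_range, jk_memA] at hp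
      by_contra hc
      apply hne
      rw [jkDn_zero α (n + 1) μ k hp.2 (jk_rowLen_zero μ _ (by omega)) hc]
      simp
  have e2 : ∑ μ ∈ jkA n, jkW α n μ =
      ∑ p ∈ (jkA n ×ˢ range (n + 1)).filter (fun p => jkAddable p.1 p.2),
        jkW α n p.1 * jkUp α (n + 1) p.1 p.2 := by
    rw [sum_filter_of_ne, sum_product]
    · refine sum_congr rfl fun μ hμ => ?_
      dsimp only
      rw [← mul_sum, jk_sum_up hα μ n (jk_memA.mp hμ), mul_one]
    · rintro ⟨μ, k⟩ hp hne
      simp only [mem_product, mem_range, jk_memA] at hp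
      by_contra hc
      apply hne
      rw [jkUp_zero α (n + 1) μ k hp.2.le hc]
      simp
  rw [e1, e2]
  symm
  refine sum_bij' (fun p _ => (jkAdd p.1 p.2, p.2)) (fun p _ => (jkRem p.1 p.2, p.2))
    ?_ ?_ ?_ ?_ ?_
  · rintro ⟨μ, k⟩ hp
    simp only [mem_filter, mem_product, mem_range, jk_memA] at hp ⊢
    exact ⟨⟨by rw [jkAdd_card hp.2, hp.1.1], hp.1.2⟩, jkAdd_removable hp.2⟩
  · rintro ⟨μ, k⟩ hp
    simp only [mem_filter, mem_product, mem_range, jk_memA] at hp ⊢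
    exact ⟨⟨by have := jkRem_card hp.2; omega, hp.1.2⟩, jkRem_addable hp.2⟩
  · rintro ⟨μ, k⟩ hp
    simp only [mem_filter, mem_product, mem_range, jk_memA] at hp ⊢
    rw [jkRem_add hp.2]
  · rintro ⟨μ, k⟩ hp
    simp only [mem_filter, mem_product, mem_range, jk_memA] at hp ⊢
    rw [jkAdd_rem hp.2]
  · rintro ⟨μ, k⟩ hp
    simp only [mem_filter, mem_product, mem_range, jk_memA] at hp ⊢
    have key := jk_key hα μ k (n + 1) hp.1.2 (jk_rowLen_zero μ _ (by omega)) hp.2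
    have q1 := (jkH_pos hα one_pos μ).ne'
    have q2 := (jkH_pos hα hα μ).ne'
    have q3 := (jkH_pos hα one_pos (jkAdd μ k)).ne'
    have q4 := (jkH_pos hα hα (jkAdd μ k)).ne'
    unfold jkW
    rw [Nat.factorial_succ, pow_succ]
    push_cast
    have q5 : ((n : ℝ) + 1) ≠ 0 := by positivity
    field_simp
    linear_combination key

lemma jk_total {α : ℝ} (hα : 0 < α) (n : ℕ) : ∑ μ ∈ jkA n, jkW α n μ = 1 := by
  induction n with
  | zero =>
    have : jkA 0 = {⊥} := by
      ext μ
      rw [jk_memA, Finset.mem_singleton]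
      constructor
      · intro h
        apply YoungDiagram.ext
        rw [YoungDiagram.cells_bot]
        exact Finset.card_eq_zero.mp h
      · rintro rfl; simp
    rw [this]
    simp [jkW, jkH]
  | succ n ih => rw [jk_step hα, ih]

/-- The Jack_α measure is a probability measure: for every `n ≥ 1` and `α > 0`, the sum over
partitions `λ` of `n` of `α^n · n! / (c_λ(α) · c'_λ(α))` equals `1`. -/
theorem jack_measure_is_probability_measure (n : ℕ) (hn : 1 ≤ n) (α : ℝ) (hα : 0 < α) :
    (∑ᶠ μ ∈ {μ : YoungDiagram | μ.card = n},
      α ^ n * (n.factorial : ℝ) / (jackC α μ * jackC' α μ)) = 1 := by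
  rw [finsum_mem_eq_finite_toFinset_sum _ (jk_finite n)]
  exact jk_total hα n
end

section
/- If a faithful character η of a finite group G is real valued and assumes m distinct values, then every irreducible character of G occurs as a constituent of η^j for some 0 ≤ j < m. -/
open FDRep CategoryTheory

lemma bb_sum_re_le (s : Multiset ℂ) (h : ∀ z ∈ s, ‖z‖ = 1) : s.sum.re ≤ s.card := by
  induction s using Multiset.induction with
  | empty => simp
  | cons a s ih =>
    have h1 := ih (fun z hz => h z (Multiset.mem_cons_of_mem hz))
    have h2 := h a (Multiset.mem_cons_self a s)
    have h3 := Complex.re_le_norm a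
    simp only [Multiset.sum_cons, Complex.add_re, Multiset.card_cons, Nat.cast_add, Nat.cast_one]
    linarith

lemma bb_all_one (s : Multiset ℂ) (h : ∀ z ∈ s, ‖z‖ = 1) (hs : s.sum = s.card) :
    ∀ z ∈ s, z = 1 := by
  intro z hz
  obtain ⟨t, rfl⟩ := Multiset.exists_cons_of_mem hz
  have h1 := bb_sum_re_le t (fun w hw => h w (Multiset.mem_cons_of_mem hw))
  have h2 := h z hz
  have h3 := Complex.re_le_norm z
  have h4 := congrArg Complex.re hs
  simp only [Multiset.sum_cons, Complex.add_re, Multiset.card_cons, Nat.cast_add, Nat.cast_one,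
    Complex.natCast_re, Complex.one_re] at h4
  have h5 : z.re = 1 := by linarith
  have h6 : z.re = ‖z‖ := by rw [h2, h5]
  have h7 := (Complex.re_eq_norm.1 h6)
  apply Complex.ext
  · simpa using h5
  · simpa using (Complex.nonneg_iff.1 h7).2.symm

open Polynomial in
lemma bb_end_eq_one {M : Type*} [AddCommGroup M] [Module ℂ M] [FiniteDimensional ℂ M]
    (T : Module.End ℂ M) (n : ℕ) (hn : n ≠ 0) (hT : T ^ n = 1)
    (htr : LinearMap.trace ℂ M T = Module.finrank ℂ M) : T = 1 := by
  have hsplit : T.charpoly.Splits := IsAlgClosed.splits _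
  have hdvd : minpoly ℂ T ∣ X ^ n - 1 := minpoly.dvd _ _ (by simp [hT])
  have hroot : ∀ z ∈ T.charpoly.roots, ‖z‖ = 1 := by
    intro z hz
    have h1 := (Module.End.hasEigenvalue_iff_isRoot_charpoly T z).2 (isRoot_of_mem_roots hz)
    have h2 := (Module.End.isRoot_of_hasEigenvalue h1).dvd hdvd
    have h3 : z ^ n = 1 := by simpa [IsRoot, sub_eq_zero] using h2
    exact Complex.norm_eq_one_of_pow_eq_one h3 hn
  have hcard : T.charpoly.roots.card = Module.finrank ℂ M := by
    rw [← T.charpoly_natDegree, hsplit.natDegree_eq_card_roots]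
  have hone := bb_all_one _ hroot (by
    rw [← Module.End.trace_eq_sum_roots_charpoly_of_splits hsplit, htr, hcard])
  have hrep := Multiset.eq_replicate_card.2 hone
  have hcp : T.charpoly = (X - C 1) ^ Module.finrank ℂ M := by
    rw [hsplit.eq_prod_roots_of_monic T.charpoly_monic, hrep, hcard]
    simp
  have hsq : Squarefree (minpoly ℂ T) :=
    (X_pow_sub_one_separable_iff.2 (by exact_mod_cast hn)).squarefree.squarefree_of_dvd hdvd
  have hd : minpoly ℂ T ∣ (X - C 1) ^ (Module.finrank ℂ M + 1) := by
    rw [pow_succ, ← hcp]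
    exact (LinearMap.minpoly_dvd_charpoly T).mul_right _
  have hd2 := (hsq.dvd_pow_iff_dvd (Nat.succ_ne_zero _)).1 hd
  have := (minpoly.dvd_iff).1 hd2
  simpa [sub_eq_zero] using this

lemma bb_pow {G : Type} [Group G] (V : FDRep ℂ G) (j : ℕ) :
    ∃ U : FDRep ℂ G, ∀ g, U.character g = V.character g ^ j := by
  induction j with
  | zero =>
    refine ⟨FDRep.of (Representation.trivial ℂ G ℂ), fun g => ?_⟩
    simp only [FDRep.character, FDRep.of_ρ', pow_zero]
    have : (Representation.trivial ℂ G ℂ) g = 1 := rfl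
    rw [this]
    exact (LinearMap.trace_one ℂ ℂ).trans (by simp)
  | succ j ih =>
    obtain ⟨U, hU⟩ := ih
    refine ⟨MonoidalCategory.tensorObj U V, fun g => ?_⟩
    rw [FDRep.char_tensor, Pi.mul_apply, hU, pow_succ]

/-- Burnside–Brauer (real-valued case): if the character `η` of a faithful representation `V`
of a finite group `G` is real valued and assumes `m` distinct values, then every irreducible
character of `G` occurs as a constituent of some power `η^j` with `0 ≤ j < m`, i.e. the
multiplicity `⟨η^j, χ^ρ⟩ = (1/|G|) Σ_g η(g)^j χ^ρ(g⁻¹)` is positive. -/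
theorem burnside_brauer_real
    {G : Type} [Group G] [Fintype G] [DecidableEq ℂ]
    (V : FDRep ℂ G)
    (hfaithful : Function.Injective V.ρ)
    (hreal : ∀ g : G, ∃ r : ℝ, V.character g = (r : ℂ))
    (W : FDRep ℂ G) (hW : Simple W) :
    ∃ j : ℕ, j < (Finset.univ.image V.character).card ∧
      0 < (((Fintype.card G : ℂ))⁻¹ *
        ∑ g : G, V.character g ^ j * W.character g⁻¹).re := by
  have hcard0 : (Nat.card G : ℂ) ≠ 0 := by exact_mod_cast Nat.card_pos.ne'
  haveI : Invertible (Nat.card G : ℂ) := invertibleOfNonzero hcard0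
  by_contra hcon
  push Not at hcon
  have hzero : ∀ j < (Finset.univ.image V.character).card,
      ∑ g : G, V.character g ^ j * W.character g⁻¹ = 0 := by
    intro j hj
    have h1 := hcon j hj
    obtain ⟨U, hU⟩ := bb_pow V j
    have h2 := FDRep.scalar_product_char_eq_finrank_equivariant W U
    simp only [hU] at h2
    rw [← Nat.card_eq_fintype_card, h2, Complex.natCast_re] at h1
    have h3 : Module.finrank ℂ (W ⟶ U) = 0 := by
      have : Module.finrank ℂ (W ⟶ U) ≤ 0 := by exact_mod_cast h1
      omega
    rw [h3, Nat.cast_zero] at h2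
    exact (mul_eq_zero.1 h2).resolve_left (inv_ne_zero hcard0)
  have hker : ∀ g : G, V.character g = V.character 1 → g = 1 := by
    intro g hg
    apply hfaithful
    rw [map_one]
    refine bb_end_eq_one (V.ρ g) (Fintype.card G) Fintype.card_ne_zero ?_ ?_
    · rw [← map_pow, pow_card_eq_one, map_one]
    · rw [FDRep.char_one] at hg
      exact hg
  set s := Finset.univ.image V.character with hs
  have hmem : ∀ g, V.character g ∈ s := fun g => Finset.mem_image_of_mem _ (Finset.mem_univ g)
  set P := Lagrange.basis s id (V.character 1) with hP
  have hinj : Set.InjOn (id : ℂ → ℂ) s := Function.injective_id.injOn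
  have hdeg : P.natDegree < s.card := by
    have := Lagrange.natDegree_basis hinj (hmem 1)
    have hpos : 0 < s.card := Finset.card_pos.2 ⟨_, hmem 1⟩
    rw [hP, this]; omega
  have hsum : ∑ g : G, P.eval (V.character g) * W.character g⁻¹ = 0 := by
    simp only [Polynomial.eval_eq_sum_range, Finset.sum_mul]
    rw [Finset.sum_comm]
    refine Finset.sum_eq_zero fun j hj => ?_
    simp only [mul_assoc, ← Finset.mul_sum]
    rw [hzero j (by have := Finset.mem_range.1 hj; omega), mul_zero]
  rw [Finset.sum_eq_single 1] at hsum
  · have h1 : P.eval (V.character 1) = 1 := Lagrange.eval_basis_self hinj (hmem 1)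
    rw [h1, one_mul, inv_one, FDRep.char_one] at hsum
    have h2 : Module.finrank ℂ W = 0 := by exact_mod_cast hsum
    haveI : Subsingleton W := Module.finrank_zero_iff.1 h2
    have h3 : ∀ g, W.character g = 0 := by
      intro g
      have : W.ρ g = 0 := LinearMap.ext fun x => Subsingleton.elim _ _
      rw [FDRep.character, this, map_zero]
    have h4 := FDRep.char_orthonormal W W
    rw [if_pos ⟨Iso.refl W⟩] at h4
    simp [h3] at h4
  · intro g _ hg
    have : P.eval (V.character g) = 0 :=
      Lagrange.eval_basis_of_ne (v := id) (fun h => hg (hker g h.symm)) (hmem g)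
    rw [this, zero_mul]
  · simp
end
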